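/- arXiv:2101.01354 — 2 statements merged into one kernel-verified Lean document; each statement's English description precedes it below -/
import Mathlib

section
/- Let G be a finite simple graph with maximum degree Δ(G) ≥ 9 such that for every vertex u of G, every vertex v in the neighbourhood N(u) of u is non-adjacent to at most three vertices of N(u). Then χ(G) ≤ max{Δ(G) − 1, ω(G)}. -/
open SimpleGraph

section BKHelpers

variable {V : Type*} [Fintype V] [DecidableEq V]

/-- `c` is a proper colouring of the subgraph of `G` induced on `T`. -/
def BKProper (G : SimpleGraph V) {k : ℕ} (c : V → Fin k) (T : Finset V) : Prop :=
  ∀ a ∈ T, ∀ b ∈ T, G.Adj a b → c a ≠ c b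

/-- Paint an independent set with a single colour. -/
lemma bk_paint (G : SimpleGraph V) {k : ℕ} (c : V → Fin k) (T E : Finset V)
    (hc : BKProper G c T) (hdis : Disjoint T E) (a : Fin k)
    (hE : ∀ e ∈ E, ∀ f ∈ E, ¬ G.Adj e f)
    (ha : ∀ e ∈ E, ∀ y ∈ T, G.Adj e y → c y ≠ a) :
    ∃ c' : V → Fin k, BKProper G c' (T ∪ E) ∧ (∀ y ∈ T, c' y = c y) ∧ ∀ e ∈ E, c' e = a := by
  have hd : ∀ y ∈ T, y ∉ E := fun y hy hy' => Finset.disjoint_left.mp hdis hy hy'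
  have h1 : ∀ y ∈ T, (fun x => if x ∈ E then a else c x) y = c y := by
    intro y hy; simp [hd y hy]
  have h2 : ∀ y ∈ E, (fun x => if x ∈ E then a else c x) y = a := by
    intro y hy; simp [hy]
  refine ⟨fun x => if x ∈ E then a else c x, ?_, h1, h2⟩
  intro x hx y hy hxy
  rcases Finset.mem_union.mp hx with hx | hx <;> rcases Finset.mem_union.mp hy with hy | hy
  · rw [h1 x hx, h1 y hy]; exact hc x hx y hy hxy
  · rw [h1 x hx, h2 y hy]; exact ha y hy x hx hxy.symm
  · rw [h2 x hx, h1 y hy]; exact (ha x hx y hy hxy).symm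
  · exact absurd hxy (hE x hx y hy)

/-- A colour outside a small set. -/
lemma bk_color {k : ℕ} (s : Finset (Fin k)) (h : s.card < k) : ∃ a, a ∉ s := by
  by_contra! hcon
  have : s = Finset.univ := by ext x; simp [hcon x]
  rw [this] at h
  simp at h

/-- Greedy extension of a colouring to a batch of vertices. -/
lemma bk_batch (G : SimpleGraph V) [DecidableRel G.Adj] {k : ℕ} (c : V → Fin k) (T Q : Finset V)
    (hc : BKProper G c T) (hdis : Disjoint T Q)
    (hQ : ∀ x ∈ Q, ∀ c' : V → Fin k, (∀ y ∈ T, c' y = c y) →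
      ((G.neighborFinset x ∩ (T ∪ Q)).image c').card < k) :
    ∃ c' : V → Fin k, BKProper G c' (T ∪ Q) ∧ (∀ y ∈ T, c' y = c y) := by
  have key : ∀ P : Finset V, P ⊆ Q →
      ∃ c' : V → Fin k, BKProper G c' (T ∪ P) ∧ (∀ y ∈ T, c' y = c y) := by
    intro P
    induction P using Finset.induction_on with
    | empty => intro _; exact ⟨c, by simpa using hc, fun _ _ => rfl⟩
    | insert x P hx ih =>
      intro hP
      obtain ⟨c', h1, h2⟩ := ih (fun y hy => hP (Finset.mem_insert_of_mem hy))
      have hxQ : x ∈ Q := hP (Finset.mem_insert_self _ _)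
      obtain ⟨a, ha⟩ := bk_color _ (hQ x hxQ c' h2)
      have hxT : x ∉ T := fun h => Finset.disjoint_left.mp hdis h hxQ
      obtain ⟨c'', h3, h4, -⟩ := bk_paint G c' (T ∪ P) {x} h1
        (by simp [hx, hxT]) a (by simp) (by
          intro e he y hy hey hya
          obtain rfl : e = x := by simpa using he
          apply ha
          rw [← hya]
          apply Finset.mem_image_of_mem
          simp only [Finset.mem_inter, mem_neighborFinset, Finset.mem_union] at hy ⊢
          refine ⟨hey, ?_⟩
          rcases hy with hy | hy
          · exact Or.inl hy
          · exact Or.inr (hP (Finset.mem_insert_of_mem hy)))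
      refine ⟨c'', ?_, fun y hy => by rw [h4 y (Finset.mem_union_left _ hy), h2 y hy]⟩
      have : T ∪ insert x P = T ∪ P ∪ {x} := by
        ext y; simp only [Finset.mem_union, Finset.mem_insert, Finset.mem_singleton]; tauto
      rw [this]; exact h3
  exact key Q (Finset.Subset.refl _)

/-- Repeated colours make the image smaller. -/
lemma bk_image {k : ℕ} (c : V → Fin k) (A E : Finset V) (hE : E ⊆ A)
    (h : ∀ e ∈ E, ∃ p ∈ A, p ∉ E ∧ c p = c e) : (A.image c).card + E.card ≤ A.card := by
  have h1 : A.image c ⊆ (A \ E).image c := by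
    intro y hy
    obtain ⟨x, hx, rfl⟩ := Finset.mem_image.mp hy
    by_cases hxE : x ∈ E
    · obtain ⟨p, hp, hpE, hpc⟩ := h x hxE
      rw [← hpc]
      exact Finset.mem_image_of_mem _ (Finset.mem_sdiff.mpr ⟨hp, hpE⟩)
    · exact Finset.mem_image_of_mem _ (Finset.mem_sdiff.mpr ⟨hx, hxE⟩)
  have h2 := (Finset.card_le_card h1).trans Finset.card_image_le
  have h3 := Finset.card_sdiff_add_card_eq_card hE
  omega

/-- Few neighbours outside the closed neighbourhood. -/
lemma bk_outside (G : SimpleGraph V) [DecidableRel G.Adj] (W : Finset V) (u v : V)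
    (hu : u ∈ W) (huv : G.Adj u v) (d : ℕ)
    (hd1 : (G.neighborFinset v ∩ W).card ≤ d)
    (hd2 : (G.neighborFinset u ∩ W).card = d) :
    (G.neighborFinset v ∩ (W \ insert u (G.neighborFinset u ∩ W))).card ≤
      ((G.neighborFinset u ∩ W).filter (fun w => w ≠ v ∧ ¬ G.Adj v w)).card := by
  set N := G.neighborFinset u ∩ W with hN
  have h1 : (G.neighborFinset v ∩ (W \ insert u N)).card + (N.filter (fun w => G.Adj v w)).card
      + 1 ≤ (G.neighborFinset v ∩ W).card := by
    have huN : u ∉ N := by simp [hN]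
    rw [← Finset.card_union_of_disjoint, ← Finset.card_insert_of_notMem (a := u)]
    · apply Finset.card_le_card
      intro x hx
      simp only [hN, Finset.mem_insert, Finset.mem_union, Finset.mem_inter, Finset.mem_filter,
        Finset.mem_sdiff, mem_neighborFinset] at hx ⊢
      rcases hx with rfl | hx | hx
      · exact ⟨huv.symm, hu⟩
      · tauto
      · tauto
    · simp [huN]
    · rw [Finset.disjoint_left]
      intro x hx hx'
      simp only [Finset.mem_insert, Finset.mem_inter, Finset.mem_filter,
        Finset.mem_sdiff] at hx hx'
      tauto
  have h2 : N.card ≤ (N.filter (fun w => G.Adj v w)).card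
      + (N.filter (fun w => w ≠ v ∧ ¬ G.Adj v w)).card + 1 := by
    have : N ⊆ insert v (N.filter (fun w => G.Adj v w) ∪
        N.filter (fun w => w ≠ v ∧ ¬ G.Adj v w)) := by
      intro x hx
      simp only [Finset.mem_insert, Finset.mem_union, Finset.mem_filter]
      tauto
    exact ((Finset.card_le_card this).trans (Finset.card_insert_le _ _)).trans
      (Nat.succ_le_succ (Finset.card_union_le _ _))
  omega

/-- Finding a colour for a set of vertices with few coloured neighbours. -/
lemma bk_free (G : SimpleGraph V) [DecidableRel G.Adj] {k : ℕ} (c : V → Fin k) (T E : Finset V)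
    (s : Finset (Fin k))
    (h : (∑ e ∈ E, (G.neighborFinset e ∩ T).card) + s.card < k) :
    ∃ a, a ∉ s ∧ ∀ e ∈ E, ∀ y ∈ T, G.Adj e y → c y ≠ a := by
  obtain ⟨a, ha⟩ := bk_color ((E.biUnion fun e => G.neighborFinset e ∩ T).image c ∪ s) (by
    refine lt_of_le_of_lt (Finset.card_union_le _ _) (lt_of_le_of_lt ?_ h)
    exact Nat.add_le_add_right (Finset.card_image_le.trans Finset.card_biUnion_le) _)
  refine ⟨a, fun h => ha (Finset.mem_union_right _ h), ?_⟩
  intro e he y hy hey hya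
  apply ha
  rw [← hya]
  apply Finset.mem_union_left
  apply Finset.mem_image_of_mem
  simp only [Finset.mem_biUnion, Finset.mem_inter, mem_neighborFinset]
  exact ⟨e, he, hey, hy⟩

lemma bk_later (G : SimpleGraph V) [DecidableRel G.Adj] (W S M : Finset V) (x : V)
    (hS : S ⊆ W) (hM : ∀ m ∈ M, m ∈ W ∧ G.Adj x m ∧ m ∉ S) :
    (G.neighborFinset x ∩ S).card + M.card ≤ (G.neighborFinset x ∩ W).card := by
  rw [← Finset.card_union_of_disjoint]
  · apply Finset.card_le_card
    intro y hy
    simp only [Finset.mem_union, Finset.mem_inter, mem_neighborFinset] at hy ⊢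
    rcases hy with hy | hy
    · exact ⟨hy.1, hS hy.2⟩
    · exact ⟨(hM y hy).2.1, (hM y hy).1⟩
  · rw [Finset.disjoint_left]
    intro y hy hy'
    exact (hM y hy').2.2 (Finset.mem_inter.mp hy).2

lemma bk_last (G : SimpleGraph V) [DecidableRel G.Adj] {k : ℕ} (c : V → Fin k) (W S : Finset V)
    (u : V) (hu : u ∈ W) (hS : S = W.erase u)
    (hc : BKProper G c S) (h : ((G.neighborFinset u ∩ W).image c).card < k) :
    ∃ c' : V → Fin k, BKProper G c' W := by
  subst hS
  obtain ⟨c', h1, -⟩ := bk_batch G c (W.erase u) {u} hc (by simp) (by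
    intro x hx c' hc'
    obtain rfl : x = u := by simpa using hx
    refine lt_of_le_of_lt (Finset.card_le_card ?_) h
    intro y hy
    simp only [Finset.mem_image, Finset.mem_inter, mem_neighborFinset, Finset.mem_union,
      Finset.mem_singleton] at hy ⊢
    obtain ⟨z, ⟨hz, hz'⟩, rfl⟩ := hy
    have hzx : z ≠ x := fun h => by subst h; exact G.loopless.irrefl _ hz
    have hzW : z ∈ W.erase x := by tauto
    exact ⟨z, ⟨hz, Finset.mem_of_mem_erase hzW⟩, (hc' z hzW).symm⟩)
  refine ⟨c', ?_⟩
  have : W.erase u ∪ {u} = W := by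
    ext y
    simp only [Finset.mem_union, Finset.mem_erase, Finset.mem_singleton]
    constructor
    · rintro (h | rfl)
      · exact h.2
      · exact hu
    · tauto
  rwa [this] at h1

/-- Regular case (Brooks). -/
lemma bk_caseA (G : SimpleGraph V) [DecidableRel G.Adj] {k : ℕ} (hk : 8 ≤ k) (c : V → Fin k)
    (W N : Finset V) (u : V) (hu : u ∈ W) (hN : N = G.neighborFinset u ∩ W)
    (hc : BKProper G c (W \ insert u N))
    (hdeg : ∀ v ∈ W, (G.neighborFinset v ∩ W).card ≤ k)
    (hout : ∀ v ∈ N, (G.neighborFinset v ∩ (W \ insert u N)).card ≤ 3)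
    (v w : V) (hv : v ∈ N) (hw : w ∈ N) (hvw : v ≠ w) (hna : ¬ G.Adj v w) :
    ∃ c' : V → Fin k, BKProper G c' W := by
  have hNm : ∀ x, x ∈ N ↔ G.Adj u x ∧ x ∈ W := by intro x; simp [hN]
  have huN : u ∉ N := by simp [hN]
  have hna' : ¬ G.Adj w v := fun h => hna h.symm
  obtain ⟨a, -, ha⟩ := bk_free G c (W \ insert u N) {v, w} ∅ (by
    rw [Finset.sum_pair hvw]
    have := hout v hv; have := hout w hw
    simp only [Finset.card_empty]; omega)
  obtain ⟨c1, p1, -, q1⟩ := bk_paint G c (W \ insert u N) {v, w} hc (by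
      rw [Finset.disjoint_left]; simp only [Finset.mem_sdiff, Finset.mem_insert,
        Finset.mem_singleton]; rintro y ⟨-, hy⟩ (rfl | rfl) <;> tauto) a (by
      simp only [Finset.mem_insert, Finset.mem_singleton]
      rintro e (rfl | rfl) f (rfl | rfl) <;> first | assumption | exact G.loopless.irrefl _) ha
  have hsub : (W \ insert u N ∪ {v, w}) ∪ (N \ {v, w}) = W.erase u := by
    ext y
    have := hNm y
    have := hNm v
    have := hNm w
    by_cases hyv : y = v
    · subst hyv; simp; grind
    by_cases hyw : y = w
    · subst hyw; simp; grind
    simp; grind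
  obtain ⟨c2, p2, q2⟩ := bk_batch G c1 (W \ insert u N ∪ {v, w}) (N \ {v, w}) p1 (by
      rw [Finset.disjoint_left]; intro y; simp; grind) (by
    intro x hx c' _
    rw [hsub]
    have hxN : x ∈ N := (Finset.mem_sdiff.mp hx).1
    have hxW := (hNm x).1 hxN
    have h1 := bk_later G W (W.erase u) {u} x (Finset.erase_subset _ _) (by
      simp only [Finset.mem_singleton]; rintro m rfl; exact ⟨hu, hxW.1.symm, by simp⟩)
    have h2 := hdeg x hxW.2
    have h3 : ((G.neighborFinset x ∩ W.erase u).image c').card ≤ _ := Finset.card_image_le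
    simp only [Finset.card_singleton] at h1
    omega)
  rw [hsub] at p2
  refine bk_last G c2 W _ u hu rfl p2 ?_
  rw [← hN]
  have h1 := bk_image c2 N {w} (by simpa using hw) (by
    simp only [Finset.mem_singleton]; rintro e rfl
    refine ⟨v, hv, hvw, ?_⟩
    rw [q2 v (by simp), q2 e (by simp), q1 v (by simp), q1 e (by simp)])
  have h2 := hdeg u hu
  rw [← hN] at h2
  simp only [Finset.card_singleton] at h1
  omega

/-- Triangle case. -/
lemma bk_caseB (G : SimpleGraph V) [DecidableRel G.Adj] {k : ℕ} (hk : 8 ≤ k) (c : V → Fin k)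
    (W N : Finset V) (u : V) (hu : u ∈ W) (hN : N = G.neighborFinset u ∩ W)
    (hc : BKProper G c (W \ insert u N))
    (hdeg : ∀ v ∈ W, (G.neighborFinset v ∩ W).card ≤ k + 1)
    (v w z : V) (hv : v ∈ N) (hw : w ∈ N) (hz : z ∈ N)
    (hvw : v ≠ w) (hvz : v ≠ z) (hwz : w ≠ z)
    (hout : ∀ x ∈ ({v, w, z} : Finset V), (G.neighborFinset x ∩ (W \ insert u N)).card ≤ 2)
    (hna : ¬ G.Adj v w) (hna2 : ¬ G.Adj v z) (hna3 : ¬ G.Adj w z)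
    (hrest : ∀ x ∈ N, x ≠ v → x ≠ w → x ≠ z → G.Adj x v ∧ G.Adj x w) :
    ∃ c' : V → Fin k, BKProper G c' W := by
  have hNm : ∀ x, x ∈ N ↔ G.Adj u x ∧ x ∈ W := by intro x; simp [hN]
  have huN : u ∉ N := by simp [hN]
  have hna' : ¬ G.Adj w v := fun h => hna h.symm
  have hna2' : ¬ G.Adj z v := fun h => hna2 h.symm
  have hna3' : ¬ G.Adj z w := fun h => hna3 h.symm
  obtain ⟨a, -, ha⟩ := bk_free G c (W \ insert u N) {v, w, z} ∅ (by
    rw [Finset.sum_insert (by simp [hvw, hvz]), Finset.sum_pair hwz]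
    have := hout v (by simp); have := hout w (by simp); have := hout z (by simp)
    simp only [Finset.card_empty]; omega)
  obtain ⟨c1, p1, -, q1⟩ := bk_paint G c (W \ insert u N) {v, w, z} hc (by
      rw [Finset.disjoint_left]; simp only [Finset.mem_sdiff, Finset.mem_insert,
        Finset.mem_singleton]; rintro y ⟨-, hy⟩ (rfl | rfl | rfl) <;> tauto) a (by
      simp only [Finset.mem_insert, Finset.mem_singleton]
      rintro e (rfl | rfl | rfl) f (rfl | rfl | rfl) <;>
        first | assumption | exact G.loopless.irrefl _) ha
  have hsub : (W \ insert u N ∪ {v, w, z}) ∪ (N \ {v, w, z}) = W.erase u := by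
    ext y
    have := hNm y
    have := hNm v
    have := hNm w
    have := hNm z
    by_cases hyv : y = v
    · subst hyv; simp; grind
    by_cases hyw : y = w
    · subst hyw; simp; grind
    by_cases hyz : y = z
    · subst hyz; simp; grind
    simp; grind
  obtain ⟨c2, p2, q2⟩ := bk_batch G c1 (W \ insert u N ∪ {v, w, z}) (N \ {v, w, z}) p1 (by
      rw [Finset.disjoint_left]; intro y; simp; grind) (by
    intro x hx c' hc'
    rw [hsub]
    have hxN : x ∈ N := (Finset.mem_sdiff.mp hx).1
    have hxW := (hNm x).1 hxN
    have hxr := hrest x hxN (by rintro rfl; simp at hx) (by rintro rfl; simp at hx)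
      (by rintro rfl; simp at hx)
    have h1 := bk_later G W (W.erase u) {u} x (Finset.erase_subset _ _) (by
      simp only [Finset.mem_singleton]; rintro m rfl; exact ⟨hu, hxW.1.symm, by simp⟩)
    have h2 := hdeg x hxW.2
    have hvu : v ≠ u := by rintro rfl; exact huN hv
    have hwu : w ≠ u := by rintro rfl; exact huN hw
    have h3 := bk_image c' (G.neighborFinset x ∩ W.erase u) {w}
      (by simp [hxr.2, hwu, ((hNm w).1 hw).2]) (by
      simp only [Finset.mem_singleton]; rintro e rfl
      refine ⟨v, by simp [hxr.1, hvu, ((hNm v).1 hv).2], hvw, ?_⟩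
      rw [hc' v (by simp), hc' e (by simp), q1 v (by simp), q1 e (by simp)])
    simp only [Finset.card_singleton] at h1 h3
    omega)
  rw [hsub] at p2
  refine bk_last G c2 W _ u hu rfl p2 ?_
  rw [← hN]
  have h1 := bk_image c2 N {w, z} (by
      intro y; simp only [Finset.mem_insert, Finset.mem_singleton]
      rintro (rfl | rfl) <;> assumption) (by
    intro e he
    refine ⟨v, hv, by simp [hvw, hvz], ?_⟩
    have he' : e ∈ ({v, w, z} : Finset V) := Finset.mem_insert_of_mem he
    rw [q2 v (by simp), q2 e (Finset.mem_union_right _ he'), q1 v (by simp), q1 e he'])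
  have h2 := hdeg u hu
  rw [← hN] at h2
  rw [Finset.card_pair hwz] at h1
  omega

set_option maxHeartbeats 2000000 in
/-- Two disjoint non-edges. -/
lemma bk_caseC (G : SimpleGraph V) [DecidableRel G.Adj] {k : ℕ} (hk : 8 ≤ k) (c : V → Fin k)
    (W N : Finset V) (u : V) (hu : u ∈ W) (hN : N = G.neighborFinset u ∩ W)
    (hNc : N.card = k + 1)
    (hc : BKProper G c (W \ insert u N))
    (hdeg : ∀ v ∈ W, (G.neighborFinset v ∩ W).card ≤ k + 1)
    (hB : ∀ x ∈ N, (N.filter (fun w => w ≠ x ∧ ¬ G.Adj x w)).card ≤ 3)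
    (hout : ∀ v ∈ N, (G.neighborFinset v ∩ (W \ insert u N)).card ≤ 3)
    (v w v' w' : V) (hv : v ∈ N) (hw : w ∈ N) (hv' : v' ∈ N) (hw' : w' ∈ N)
    (hvw : v ≠ w) (hvw' : v' ≠ w') (d1 : v ≠ v') (d2 : v ≠ w') (d3 : w ≠ v') (d4 : w ≠ w')
    (hna : ¬ G.Adj v w) (hna' : ¬ G.Adj v' w') :
    ∃ c' : V → Fin k, BKProper G c' W := by
  have hNm : ∀ x, x ∈ N ↔ G.Adj u x ∧ x ∈ W := by intro x; simp [hN]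
  have huN : u ∉ N := by simp [hN]
  have hnas : ¬ G.Adj w v := fun h => hna h.symm
  have hnas' : ¬ G.Adj w' v' := fun h => hna' h.symm
  set T := W \ insert u N with hT
  have hTN : ∀ y ∈ T, y ∉ N := by intro y hy; simp [hT] at hy; tauto
  obtain ⟨a, -, ha⟩ := bk_free G c T {v, w} ∅ (by
    rw [Finset.sum_pair hvw]
    have := hout v hv; have := hout w hw
    simp only [Finset.card_empty]; omega)
  obtain ⟨c1, p1, r1, q1⟩ := bk_paint G c T {v, w} hc (by
      rw [Finset.disjoint_left]; simp only [Finset.mem_insert, Finset.mem_singleton]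
      rintro y hy (rfl | rfl) <;> exact hTN _ hy (by assumption)) a (by
      simp only [Finset.mem_insert, Finset.mem_singleton]
      rintro e (rfl | rfl) f (rfl | rfl) <;> first | assumption | exact G.loopless.irrefl _) ha
  obtain ⟨b, hab, hb⟩ := bk_free G c1 T {v', w'} {a} (by
    rw [Finset.sum_pair hvw']
    have := hout v' hv'; have := hout w' hw'
    simp only [Finset.card_singleton]; omega)
  have hab : a ≠ b := by rintro rfl; simp at hab
  obtain ⟨c2, p2, r2, q2⟩ := bk_paint G c1 (T ∪ {v, w}) {v', w'} p1 (by
      rw [Finset.disjoint_left]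
      simp only [Finset.mem_insert, Finset.mem_singleton, Finset.mem_union]
      rintro y (hy | rfl | rfl) (rfl | rfl)
      all_goals first | exact hTN _ hy (by assumption) | contradiction) b (by
      simp only [Finset.mem_insert, Finset.mem_singleton]
      rintro e (rfl | rfl) f (rfl | rfl) <;> first | assumption | exact G.loopless.irrefl _) (by
      intro e he y hy hey
      rcases Finset.mem_union.mp hy with hy | hy
      · exact hb e he y hy hey
      · rw [q1 y hy]; exact hab)
  set T2 := T ∪ {v, w} ∪ {v', w'} with hT2
  have c2v : c2 v = c2 w := by
    rw [r2 v (by simp), r2 w (by simp), q1 v (by simp), q1 w (by simp)]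
  have c2v' : c2 v' = c2 w' := by rw [q2 v' (by simp), q2 w' (by simp)]
  have vT2 : v ∈ T2 := by simp [hT2]
  have wT2 : w ∈ T2 := by simp [hT2]
  have vT2' : v' ∈ T2 := by simp [hT2]
  have wT2' : w' ∈ T2 := by simp [hT2]
  set R := N \ {v, w, v', w'} with hR
  have hRm : ∀ x, x ∈ R ↔ x ∈ N ∧ x ≠ v ∧ x ≠ w ∧ x ≠ v' ∧ x ≠ w' := by
    intro x; simp [hR]
  have hRT : ∀ x ∈ R, x ∉ T2 := by
    intro x hx hx'
    have h1 := (hRm x).1 hx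
    simp only [hT2, Finset.mem_union, Finset.mem_insert, Finset.mem_singleton] at hx'
    have := hTN x
    tauto
  have hWu : T2 ∪ R = W.erase u := by
    ext y
    have e1 := hNm y
    have hvu := (hNm v).1 hv
    have hwu := (hNm w).1 hw
    have hvu' := (hNm v').1 hv'
    have hwu' := (hNm w').1 hw'
    simp only [hT2, hT, Finset.mem_union, hRm, Finset.mem_erase, Finset.mem_sdiff,
      Finset.mem_insert, Finset.mem_singleton]
    by_cases y = u
    · subst y
      have n1 : u ≠ v := by rintro rfl; exact huN hv
      have n2 : u ≠ w := by rintro rfl; exact huN hw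
      have n3 : u ≠ v' := by rintro rfl; exact huN hv'
      have n4 : u ≠ w' := by rintro rfl; exact huN hw'
      tauto
    · grind
  have hRc : R.card + 4 = k + 1 := by
    rw [← hNc, hR]
    have h4 : ({v, w, v', w'} : Finset V).card = 4 := by
      rw [Finset.card_insert_of_notMem (by simp [hvw, d1, d2]),
        Finset.card_insert_of_notMem (by simp [d3, d4]), Finset.card_pair hvw']
    rw [← h4]
    apply Finset.card_sdiff_add_card_eq_card
    intro y; simp only [Finset.mem_insert, Finset.mem_singleton]
    rintro (rfl | rfl | rfl | rfl) <;> assumption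
  -- good and bad vertices
  set D := R.filter (fun x => (¬ G.Adj x v ∨ ¬ G.Adj x w) ∧ (¬ G.Adj x v' ∨ ¬ G.Adj x w')) with hD
  set Q2 := R \ D with hQ2
  set Q1 := D.filter (fun x => ∃ g ∈ Q2, G.Adj x g) with hQ1
  set Q0 := D \ Q1 with hQ0
  have hDR : D ⊆ R := Finset.filter_subset _ _
  have hBx : ∀ x ∈ N, ∀ s : Finset V, (∀ y ∈ s, y ∈ N ∧ y ≠ x ∧ ¬ G.Adj x y) → s.card ≤ 3 := by
    intro x hx s hs
    refine (Finset.card_le_card ?_).trans (hB x hx)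
    intro y hy
    rw [Finset.mem_filter]
    exact hs y hy
  have hDc : D.card ≤ 4 := by
    have e1 : D ⊆ D.filter (fun x => ¬ G.Adj v x) ∪ D.filter (fun x => ¬ G.Adj w x) := by
      intro x hx
      have hx' := (Finset.mem_filter.mp hx).2.1
      rw [G.adj_comm x v, G.adj_comm x w] at hx'
      simp only [Finset.mem_union, Finset.mem_filter]
      tauto
    have e2 : (D.filter (fun x => ¬ G.Adj v x)).card + 1 ≤ 3 := by
      rw [← Finset.card_insert_of_notMem (a := w)]
      · apply hBx v hv
        intro y hy
        rcases Finset.mem_insert.mp hy with rfl | hy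
        · exact ⟨hw, hvw.symm, hna⟩
        · have := Finset.mem_filter.mp hy
          have h' := (hRm y).1 (hDR this.1)
          exact ⟨h'.1, h'.2.1, this.2⟩
      · intro h
        have h' := (hRm w).1 (hDR (Finset.mem_filter.mp h).1)
        exact h'.2.2.1 rfl
    have e3 : (D.filter (fun x => ¬ G.Adj w x)).card + 1 ≤ 3 := by
      rw [← Finset.card_insert_of_notMem (a := v)]
      · apply hBx w hw
        intro y hy
        rcases Finset.mem_insert.mp hy with rfl | hy
        · exact ⟨hv, hvw, hnas⟩
        · have := Finset.mem_filter.mp hy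
          have h' := (hRm y).1 (hDR this.1)
          exact ⟨h'.1, h'.2.2.1, this.2⟩
      · intro h
        have h' := (hRm v).1 (hDR (Finset.mem_filter.mp h).1)
        exact h'.2.1 rfl
    have e4 := (Finset.card_le_card e1).trans (Finset.card_union_le _ _)
    omega
  have hQ2c : Q2.card + D.card = R.card := Finset.card_sdiff_add_card_eq_card hDR
  have hQ2R : Q2 ⊆ R := Finset.sdiff_subset
  -- each bad vertex has at most one non-neighbour in R
  have hDB : ∀ x ∈ D, ∀ s ⊆ R, (∀ y ∈ s, y ≠ x ∧ ¬ G.Adj x y) → s.card ≤ 1 := by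
    intro x hx s hsR hs
    have hx' := Finset.mem_filter.mp hx
    have hxR := (hRm x).1 hx'.1
    obtain ⟨p, hp, hpN, hpx, hpa⟩ : ∃ p, (p = v ∨ p = w) ∧ p ∈ N ∧ p ≠ x ∧ ¬ G.Adj x p := by
      rcases hx'.2.1 with h | h
      · exact ⟨v, Or.inl rfl, hv, hxR.2.1.symm, h⟩
      · exact ⟨w, Or.inr rfl, hw, hxR.2.2.1.symm, h⟩
    obtain ⟨q, hq, hqN, hqx, hqa⟩ : ∃ p, (p = v' ∨ p = w') ∧ p ∈ N ∧ p ≠ x ∧ ¬ G.Adj x p := by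
      rcases hx'.2.2 with h | h
      · exact ⟨v', Or.inl rfl, hv', hxR.2.2.2.1.symm, h⟩
      · exact ⟨w', Or.inr rfl, hw', hxR.2.2.2.2.symm, h⟩
    have hpq : p ≠ q := by
      rcases hp with rfl | rfl <;> rcases hq with rfl | rfl <;> assumption
    have hps : p ∉ s := by
      intro h; have := (hRm p).1 (hsR h); tauto
    have hqs : q ∉ s := by
      intro h; have := (hRm q).1 (hsR h); tauto
    have h3 : (insert p (insert q s)).card ≤ 3 := by
      apply hBx x hxR.1
      intro y hy
      rcases Finset.mem_insert.mp hy with rfl | hy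
      · exact ⟨hpN, hpx, hpa⟩
      rcases Finset.mem_insert.mp hy with rfl | hy
      · exact ⟨hqN, hqx, hqa⟩
      · exact ⟨((hRm y).1 (hsR hy)).1, hs y hy⟩
    rw [Finset.card_insert_of_notMem (by simp [hpq, hps]),
      Finset.card_insert_of_notMem hqs] at h3
    omega
  have hQ0 : ∀ x ∈ Q0, ∃ y ∈ Q1, G.Adj x y := by
    intro x hx
    obtain ⟨hxD, hx1⟩ := Finset.mem_sdiff.mp hx
    have hxQ2 : x ∉ Q2 := fun h => (Finset.mem_sdiff.mp h).2 hxD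
    have hxg : ∀ g ∈ Q2, ¬ G.Adj x g := by
      intro g hg hxg
      exact hx1 (Finset.mem_filter.mpr ⟨hxD, g, hg, hxg⟩)
    have h1 : Q2.card ≤ 1 := hDB x hxD Q2 hQ2R (fun y hy =>
      ⟨by rintro rfl; exact hxQ2 hy, hxg y hy⟩)
    have h2 : Q2.card = 1 := by omega
    obtain ⟨g, hg⟩ := Finset.card_eq_one.mp h2
    have hgQ : g ∈ Q2 := by simp [hg]
    have hgR := hQ2R hgQ
    have hgD : g ∉ D := (Finset.mem_sdiff.mp hgQ).2
    obtain ⟨y, hyD, hyg⟩ : ∃ y ∈ D, G.Adj g y := by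
      by_contra! hcon
      have := hBx g ((hRm g).1 hgR).1 D (fun y hy =>
        ⟨((hRm y).1 (hDR hy)).1, by rintro rfl; exact hgD hy, hcon y hy⟩)
      omega
    refine ⟨y, Finset.mem_filter.mpr ⟨hyD, g, hgQ, hyg.symm⟩, ?_⟩
    by_contra hxy
    have hyx : y ≠ x := by rintro rfl; exact hxg g hgQ hyg.symm
    have hyg' : y ≠ g := by rintro rfl; exact hgD hyD
    have := hDB x hxD {y, g} (by
      intro t; simp only [Finset.mem_insert, Finset.mem_singleton]
      rintro (rfl | rfl)
      · exact hDR hyD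
      · exact hgR) (by
      intro t; simp only [Finset.mem_insert, Finset.mem_singleton]
      rintro (rfl | rfl)
      · exact ⟨hyx, hxy⟩
      · exact ⟨by rintro rfl; exact hxQ2 hgQ, hxg _ hgQ⟩)
    rw [Finset.card_pair hyg'] at this
    omega
  have hQ1D : Q1 ⊆ D := Finset.filter_subset _ _
  have hQ0D : Q0 ⊆ D := Finset.sdiff_subset
  have hD01 : ∀ x ∈ Q0, x ∉ Q1 := fun x hx => (Finset.mem_sdiff.mp hx).2
  have hD2 : ∀ x ∈ D, x ∉ Q2 := fun x hx h => (Finset.mem_sdiff.mp h).2 hx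
  have hT2W : T2 ⊆ W.erase u := hWu ▸ Finset.subset_union_left
  have hRW : R ⊆ W.erase u := hWu ▸ Finset.subset_union_right
  -- later neighbour bound
  have hlater : ∀ x ∈ R, ∀ S ⊆ W.erase u, ∀ g ∈ R, g ∉ S → G.Adj x g → ∀ c' : V → Fin k,
      ((G.neighborFinset x ∩ S).image c').card < k := by
    intro x hx S hS g hg hgS hxg c'
    have hxW := (hNm x).1 ((hRm x).1 hx).1
    have hgW := (hNm g).1 ((hRm g).1 hg).1
    have hug : u ≠ g := by rintro rfl; exact huN ((hRm _).1 hg).1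
    have h1 := bk_later G W S {u, g} x (hS.trans (Finset.erase_subset _ _)) (by
      simp only [Finset.mem_insert, Finset.mem_singleton]
      rintro m (rfl | rfl)
      · exact ⟨hu, hxW.1.symm, fun h => by simpa using hS h⟩
      · exact ⟨hgW.2, hxg, hgS⟩)
    have h2 := hdeg x hxW.2
    have h3 : ((G.neighborFinset x ∩ S).image c').card ≤ _ := Finset.card_image_le
    rw [Finset.card_pair hug] at h1
    omega
  obtain ⟨c3, p3, r3⟩ := bk_batch G c2 T2 Q0 p2
    (Finset.disjoint_right.mpr fun x hx => hRT x (hDR (hQ0D hx))) (by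
    intro x hx c' _
    obtain ⟨y, hy, hxy⟩ := hQ0 x hx
    refine hlater x (hDR (hQ0D hx)) _ (Finset.union_subset hT2W
      ((hQ0D.trans hDR).trans hRW)) y (hDR (hQ1D hy)) ?_ hxy c'
    rw [Finset.mem_union]
    rintro (h | h)
    · exact hRT y (hDR (hQ1D hy)) h
    · exact hD01 y h hy)
  obtain ⟨c4, p4, r4⟩ := bk_batch G c3 (T2 ∪ Q0) Q1 p3
    (Finset.disjoint_right.mpr fun x hx h => by
      rcases Finset.mem_union.mp h with h | h
      · exact hRT x (hDR (hQ1D hx)) h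
      · exact hD01 x h hx) (by
    intro x hx c' _
    obtain ⟨hxD, y, hy, hxy⟩ := Finset.mem_filter.mp hx
    refine hlater x (hDR hxD) _ (Finset.union_subset (Finset.union_subset hT2W
      ((hQ0D.trans hDR).trans hRW)) ((hQ1D.trans hDR).trans hRW)) y (hQ2R hy) ?_ hxy c'
    rw [Finset.mem_union, Finset.mem_union]
    rintro ((h | h) | h)
    · exact hRT y (hQ2R hy) h
    · exact hD2 y (hQ0D h) hy
    · exact hD2 y (hQ1D h) hy)
  have hall : T2 ∪ Q0 ∪ Q1 ∪ Q2 = W.erase u := by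
    rw [← hWu]
    ext y
    have h1 : y ∈ Q2 ↔ y ∈ R ∧ y ∉ D := Finset.mem_sdiff
    have h2 : y ∈ Q0 ↔ y ∈ D ∧ y ∉ Q1 := Finset.mem_sdiff
    have h3 := @hQ1D y
    have h4 := @hDR y
    simp only [Finset.mem_union]
    tauto
  have hagree4 : ∀ y ∈ T2, c4 y = c2 y := fun y hy => by
    rw [r4 y (Finset.mem_union_left _ hy), r3 y hy]
  obtain ⟨c5, p5, r5⟩ := bk_batch G c4 (T2 ∪ Q0 ∪ Q1) Q2 p4
    (Finset.disjoint_right.mpr fun x hx h => by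
      rcases Finset.mem_union.mp h with h | h
      · rcases Finset.mem_union.mp h with h | h
        · exact hRT x (hQ2R hx) h
        · exact hD2 x (hQ0D h) hx
      · exact hD2 x (hQ1D h) hx) (by
    intro x hx c' hc'
    rw [hall]
    obtain ⟨hxR, hxD⟩ := Finset.mem_sdiff.mp hx
    have hxW := (hNm x).1 ((hRm x).1 hxR).1
    obtain ⟨p, q, hp, hq, hpq, hxp, hxq, hcpq⟩ : ∃ p q, p ∈ T2 ∧ q ∈ T2 ∧ p ≠ q ∧
        G.Adj x p ∧ G.Adj x q ∧ c2 p = c2 q := by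
      have : ¬ ((¬ G.Adj x v ∨ ¬ G.Adj x w) ∧ (¬ G.Adj x v' ∨ ¬ G.Adj x w')) :=
        fun h => hxD (Finset.mem_filter.mpr ⟨hxR, h⟩)
      by_cases h : G.Adj x v ∧ G.Adj x w
      · exact ⟨v, w, vT2, wT2, hvw, h.1, h.2, c2v⟩
      · have : G.Adj x v' ∧ G.Adj x w' := by tauto
        exact ⟨v', w', vT2', wT2', hvw', this.1, this.2, c2v'⟩
    have hc'' : ∀ y ∈ T2, c' y = c2 y := fun y hy => by
      rw [hc' y (by simp [hy]), hagree4 y hy]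
    have h1 := bk_later G W (W.erase u) {u} x (Finset.erase_subset _ _) (by
      simp only [Finset.mem_singleton]; rintro m rfl; exact ⟨hu, hxW.1.symm, by simp⟩)
    have h2 := hdeg x hxW.2
    have h3 := bk_image c' (G.neighborFinset x ∩ W.erase u) {q}
      (by
        rw [Finset.singleton_subset_iff, Finset.mem_inter, mem_neighborFinset]
        exact ⟨hxq, hT2W hq⟩) (by
      simp only [Finset.mem_singleton]; rintro e rfl
      refine ⟨p, ?_, hpq, ?_⟩
      · rw [Finset.mem_inter, mem_neighborFinset]
        exact ⟨hxp, hT2W hp⟩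
      · rw [hc'' p hp, hc'' e hq, hcpq])
    simp only [Finset.card_singleton] at h1 h3
    omega)
  rw [hall] at p5
  have h5 : ∀ y ∈ T2, c5 y = c2 y := fun y hy => by
    rw [r5 y (by simp [hy]), hagree4 y hy]
  refine bk_last G c5 W _ u hu rfl p5 ?_
  rw [← hN]
  have h1 := bk_image c5 N {w, w'} (by
      intro y; simp only [Finset.mem_insert, Finset.mem_singleton]
      rintro (rfl | rfl) <;> assumption) (by
    intro e; simp only [Finset.mem_insert, Finset.mem_singleton]
    rintro (rfl | rfl)
    · refine ⟨v, hv, by tauto, ?_⟩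
      rw [h5 v vT2, h5 _ wT2, c2v]
    · refine ⟨v', hv', ?_, ?_⟩
      · rintro (h | h)
        · exact d3 h.symm
        · exact hvw' h
      · rw [h5 v' vT2', h5 _ wT2', c2v'])
  rw [Finset.card_pair d4] at h1
  omega

/-- Every vertex set can be coloured. -/
lemma bk_main (G : SimpleGraph V) [DecidableRel G.Adj] {k : ℕ} (hk : 8 ≤ k)
    (hdeg : ∀ v, G.degree v ≤ k + 1)
    (hclique : ∀ s : Finset V, G.IsClique s → s.card ≤ k)
    (hdense : ∀ u : V, ∀ v ∈ G.neighborFinset u,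
      ((G.neighborFinset u).filter (fun w => w ≠ v ∧ ¬ G.Adj v w)).card ≤ 3)
    (W : Finset V) : ∃ c : V → Fin k, BKProper G c W := by
  induction W using Finset.strongInduction with
  | H W ih =>
  by_cases hlow : ∃ v ∈ W, (G.neighborFinset v ∩ W).card < k
  · obtain ⟨v, hv, hvd⟩ := hlow
    obtain ⟨c, hc⟩ := ih (W.erase v) (Finset.erase_ssubset hv)
    exact bk_last G c W _ v hv rfl hc (lt_of_le_of_lt Finset.card_image_le hvd)
  push Not at hlow
  rcases W.eq_empty_or_nonempty with rfl | hne
  · exact ⟨fun _ => ⟨0, by omega⟩, by intro a ha; simp at ha⟩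
  have hdegW : ∀ v ∈ W, (G.neighborFinset v ∩ W).card ≤ k + 1 := fun v _ =>
    (Finset.card_le_card Finset.inter_subset_left).trans (by
      rw [G.card_neighborFinset_eq_degree]; exact hdeg v)
  have hB : ∀ u, ∀ x ∈ G.neighborFinset u ∩ W,
      ((G.neighborFinset u ∩ W).filter (fun w => w ≠ x ∧ ¬ G.Adj x w)).card ≤ 3 := by
    intro u x hx
    exact (Finset.card_le_card (Finset.filter_subset_filter _ Finset.inter_subset_left)).trans
      (hdense u x (Finset.mem_inter.mp hx).1)
  -- reduced colouring
  have hred : ∀ u ∈ W, ∃ c : V → Fin k,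
      BKProper G c (W \ insert u (G.neighborFinset u ∩ W)) := by
    intro u hu
    apply ih
    refine Finset.ssubset_iff_subset_ne.mpr ⟨Finset.sdiff_subset, fun h => ?_⟩
    have : u ∈ W \ insert u (G.neighborFinset u ∩ W) := by rw [h]; exact hu
    simp at this
  by_cases hbig : ∃ u ∈ W, (G.neighborFinset u ∩ W).card = k + 1
  · obtain ⟨u, hu, hud⟩ := hbig
    obtain ⟨c, hc⟩ := hred u hu
    have hBu := hB u
    have hout0 : ∀ v ∈ G.neighborFinset u ∩ W, _ := fun v hv =>
      bk_outside G W u v hu (by simpa using (Finset.mem_inter.mp hv).1) (k + 1)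
        (hdegW v (Finset.mem_inter.mp hv).2) hud
    generalize hN : G.neighborFinset u ∩ W = N at *
    have hNm : ∀ x, x ∈ N ↔ G.Adj u x ∧ x ∈ W := by intro x; simp [← hN]
    by_cases hpairs : ∃ v ∈ N, ∃ w ∈ N, ∃ v' ∈ N, ∃ w' ∈ N, v ≠ w ∧ v' ≠ w' ∧ v ≠ v' ∧ v ≠ w' ∧
        w ≠ v' ∧ w ≠ w' ∧ ¬ G.Adj v w ∧ ¬ G.Adj v' w'
    · obtain ⟨v, hv, w, hw, v', hv', w', hw', h1, h2, h3, h4, h5, h6, h7, h8⟩ := hpairs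
      exact bk_caseC G hk c W N u hu hN.symm hud hc hdegW hBu
        (fun v hv => (hout0 v hv).trans (hBu v hv)) v w v' w' hv hw hv' hw' h1 h2 h3 h4 h5 h6 h7 h8
    have hP : ∀ v ∈ N, ∀ w ∈ N, ∀ v' ∈ N, ∀ w' ∈ N, v ≠ w → v' ≠ w' → v ≠ v' → v ≠ w' →
        w ≠ v' → w ≠ w' → ¬ G.Adj v w → G.Adj v' w' := by
      intro v hv w hw v' hv' w' hw' h1 h2 h3 h4 h5 h6 h7
      by_contra h8
      exact hpairs ⟨v, hv, w, hw, v', hv', w', hw', h1, h2, h3, h4, h5, h6, h7, h8⟩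
    -- deleting one vertex from N never leaves a clique
    have hnc : ∀ t, ∃ x ∈ N, ∃ y ∈ N, x ≠ t ∧ y ≠ t ∧ x ≠ y ∧ ¬ G.Adj x y := by
      intro t
      by_contra! hcon
      have huN : u ∉ N.erase t := by simp [hNm]
      have := hclique (insert u (N.erase t)) (by
        intro x hx y hy hxy
        simp only [Finset.coe_insert, Set.mem_insert_iff, Finset.mem_coe,
          Finset.mem_erase] at hx hy
        rcases hx with rfl | hx <;> rcases hy with rfl | hy
        · exact absurd rfl hxy
        · exact ((hNm y).1 hy.2).1
        · exact ((hNm x).1 hx.2).1.symm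
        · exact hcon x hx.2 y hy.2 hx.1 hy.1 hxy)
      rw [Finset.card_insert_of_notMem huN] at this
      have h2 := Finset.pred_card_le_card_erase (s := N) (a := t)
      omega
    obtain ⟨v, hv, w, hw, -, -, hvw, hna⟩ := hnc u
    obtain ⟨x, hx, y, hy, hxv, hyv, hxy, hxy'⟩ := hnc v
    -- the non-edge xy meets vw, so it contains w
    obtain ⟨z, hz, hzv, hzw, hwz⟩ : ∃ z ∈ N, z ≠ v ∧ z ≠ w ∧ ¬ G.Adj w z := by
      by_cases h1 : x = w
      · subst h1; exact ⟨y, hy, hyv, hxy.symm, hxy'⟩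
      by_cases h2 : y = w
      · subst h2; exact ⟨x, hx, hxv, hxy, fun h => hxy' h.symm⟩
      · exact absurd (hP v hv w hw x hx y hy hvw hxy hxv.symm hyv.symm (Ne.symm h1) (Ne.symm h2)
          hna) hxy'
    obtain ⟨x, hx, y, hy, hxw, hyw, hxy, hxy'⟩ := hnc w
    have hvz : ¬ G.Adj v z := by
      -- xy avoids w, meets vw in v, meets wz in z
      have hxvy : x = v ∨ y = v := by
        by_contra! h
        exact hxy' (hP v hv w hw x hx y hy hvw hxy h.1.symm h.2.symm hxw.symm hyw.symm hna)
      have hxzy : x = z ∨ y = z := by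
        by_contra! h
        exact hxy' (hP w hw z hz x hx y hy hzw.symm hxy hxw.symm hyw.symm h.1.symm h.2.symm hwz)
      rcases hxvy with rfl | rfl <;> rcases hxzy with rfl | rfl
      · exact absurd rfl hzv
      · exact hxy'
      · exact fun h => hxy' h.symm
      · exact absurd rfl hzv
    have hr : ∀ t ∈ N, t ≠ v → t ≠ w → t ≠ z → G.Adj t v ∧ G.Adj t w ∧ G.Adj t z := by
      intro t ht h1 h2 h3
      exact ⟨hP w hw z hz t ht v hv hzw.symm h1 h2.symm hvw.symm h3.symm hzv hwz,
        hP v hv z hz t ht w hw hzv.symm h2 h1.symm hvw h3.symm hzw hvz,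
        hP v hv w hw t ht z hz hvw h3 h1.symm hzv.symm h2.symm hzw.symm hna⟩
    refine bk_caseB G hk c W N u hu hN.symm hc hdegW v w z hv hw hz hvw hzv.symm hzw.symm ?_
      hna hvz hwz (fun t ht h1 h2 h3 => ⟨(hr t ht h1 h2 h3).1, (hr t ht h1 h2 h3).2.1⟩)
    have htwo : ∀ t ∈ N, ∀ p q : V, (∀ s ∈ N, s ≠ t → ¬ G.Adj t s → s = p ∨ s = q) →
        (G.neighborFinset t ∩ (W \ insert u N)).card ≤ 2 := by
      intro t ht p q h
      refine (hout0 t ht).trans ((Finset.card_le_card (t := {p, q}) ?_).trans Finset.card_le_two)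
      intro s hs
      obtain ⟨hs1, hs2, hs3⟩ := Finset.mem_filter.mp hs
      simpa using h s hs1 hs2 hs3
    intro t ht
    simp only [Finset.mem_insert, Finset.mem_singleton] at ht
    rcases ht with rfl | rfl | rfl
    · refine htwo t hv w z fun s hs h1 h2 => ?_
      by_contra! h
      exact h2 (hr s hs h1 h.1 h.2).1.symm
    · refine htwo t hw v z fun s hs h1 h2 => ?_
      by_contra! h
      exact h2 (hr s hs h.1 h1 h.2).2.1.symm
    · refine htwo t hz v w fun s hs h1 h2 => ?_
      by_contra! h
      exact h2 (hr s hs h.1 h.2 h1).2.2.symm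
  · have hdegk : ∀ v ∈ W, (G.neighborFinset v ∩ W).card ≤ k := by
      intro v hv
      have h1 := hdegW v hv
      have h2 : (G.neighborFinset v ∩ W).card ≠ k + 1 := fun h => hbig ⟨v, hv, h⟩
      omega
    obtain ⟨u, hu⟩ := hne
    have hud : (G.neighborFinset u ∩ W).card = k := le_antisymm (hdegk u hu) (hlow u hu)
    obtain ⟨c, hc⟩ := hred u hu
    have hout0 : ∀ v ∈ G.neighborFinset u ∩ W, _ := fun v hv =>
      (bk_outside G W u v hu (by simpa using (Finset.mem_inter.mp hv).1) k
        (hdegk v (Finset.mem_inter.mp hv).2) hud).trans (hB u v hv)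
    have hnc : ∃ x ∈ G.neighborFinset u ∩ W, ∃ y ∈ G.neighborFinset u ∩ W,
        x ≠ y ∧ ¬ G.Adj x y := by
      by_contra! hcon
      have huN : u ∉ G.neighborFinset u ∩ W := by simp
      have := hclique (insert u (G.neighborFinset u ∩ W)) (by
        intro x hx y hy hxy
        rw [Finset.mem_coe, Finset.mem_insert] at hx hy
        rcases hx with rfl | hx <;> rcases hy with rfl | hy
        · exact absurd rfl hxy
        · simpa using (Finset.mem_inter.mp hy).1
        · simpa [G.adj_comm] using (Finset.mem_inter.mp hx).1
        · exact hcon x hx y hy hxy)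
      rw [Finset.card_insert_of_notMem huN] at this
      omega
    obtain ⟨x, hx, y, hy, hxy, hna⟩ := hnc
    exact bk_caseA G hk c W _ u hu rfl hc hdegk hout0 x y hx hy hxy hna

end BKHelpers

theorem borodin_kostochka_dense_neighbourhoods
    {V : Type*} [Fintype V] [DecidableEq V]
    (G : SimpleGraph V) [DecidableRel G.Adj]
    (hΔ : 9 ≤ G.maxDegree)
    (hdense : ∀ u : V, ∀ v ∈ G.neighborFinset u,
      ((G.neighborFinset u).filter (fun w => w ≠ v ∧ ¬ G.Adj v w)).card ≤ 3) :
    G.chromaticNumber ≤ (↑(max (G.maxDegree - 1) G.cliqueNum) : ℕ∞) := by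
  have h1 : G.maxDegree - 1 ≤ max (G.maxDegree - 1) G.cliqueNum := le_max_left _ _
  have h2 : G.cliqueNum ≤ max (G.maxDegree - 1) G.cliqueNum := le_max_right _ _
  obtain ⟨c, hc⟩ := bk_main G (k := max (G.maxDegree - 1) G.cliqueNum) (by omega)
    (fun v => (G.degree_le_maxDegree v).trans (by omega))
    (fun s hs => hs.card_le_cliqueNum.trans h2) hdense Finset.univ
  have : G.Colorable (max (G.maxDegree - 1) G.cliqueNum) :=
    ⟨Coloring.mk c (fun {a b} hab => hc a (Finset.mem_univ _) b (Finset.mem_univ _) hab)⟩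
  exact this.chromaticNumber_le
end

section
/- Let G be a finite simple graph with maximum degree Δ(G) ≥ 9 that is (P4 ∪ K1)-free, i.e., G contains no induced subgraph isomorphic to the disjoint union of a path on 4 vertices and a single isolated vertex. Then χ(G) ≤ max{Δ(G) − 1, ω(G)}. -/
open SimpleGraph

/-- `P4 ∪ K1`: the path `0 – 1 – 2 – 3` on four vertices together with the
isolated vertex `4`. -/
def P4UnionK1 : SimpleGraph (Fin 5) :=
  SimpleGraph.fromRel (fun a b =>
    (a = 0 ∧ b = 1) ∨ (a = 1 ∧ b = 2) ∨ (a = 2 ∧ b = 3))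


namespace BK

set_option linter.unusedSectionVars false

open Classical in
/-- neighbourhood as a finset -/
noncomputable def nb {V : Type*} [Fintype V] (G : SimpleGraph V) (v : V) : Finset V :=
  Finset.univ.filter (fun u => G.Adj v u)

/-- `f` is a proper colouring of `G - v`. -/
def PropOff {V : Type*} (G : SimpleGraph V) {k : ℕ} (f : V → Fin k) (v : V) : Prop :=
  ∀ a b, a ≠ v → b ≠ v → G.Adj a b → f a ≠ f b

/-- `x` is the only neighbour of `v` having its colour. -/
def Uniq {V : Type*} (G : SimpleGraph V) {k : ℕ} (f : V → Fin k) (v x : V) : Prop :=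
  ∀ y, G.Adj v y → f y = f x → y = x

/-- minimal counterexample -/
structure Crit {V : Type*} [Fintype V] (G : SimpleGraph V) (k : ℕ) : Prop where
  hk : 8 ≤ k
  hdeg : ∀ v, (nb G v).card ≤ k + 1
  hcl : ∀ s : Finset V, (∀ a ∈ s, ∀ b ∈ s, a ≠ b → G.Adj a b) → s.card ≤ k
  hnc : ∀ f : V → Fin k, ¬ ∀ a b, G.Adj a b → f a ≠ f b
  hcrit : ∀ v, ∃ f : V → Fin k, PropOff G f v
  hp : ∀ a b c d x, G.Adj a b → G.Adj b c → G.Adj c d → ¬ G.Adj a c → ¬ G.Adj a d →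
    ¬ G.Adj b d → ¬ G.Adj x a → ¬ G.Adj x b → ¬ G.Adj x c → ¬ G.Adj x d → False

section
variable {V : Type*} [Fintype V] {G : SimpleGraph V} {k : ℕ}

theorem mem_nb {v u : V} : u ∈ nb G v ↔ G.Adj v u := by simp [nb]

open Classical in
theorem F1 (h : Crit G k) {v : V} {f : V → Fin k} (hf : PropOff G f v) (c : Fin k) :
    ∃ w, G.Adj v w ∧ f w = c := by
  by_contra hcon
  push Not at hcon
  apply h.hnc (Function.update f v c)
  intro a b hab
  have hne := hab.ne
  by_cases ha : a = v
  · subst ha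
    rw [Function.update_self, Function.update_of_ne hne.symm]
    exact fun e => hcon b hab e.symm
  · by_cases hb : b = v
    · subst hb
      rw [Function.update_self, Function.update_of_ne ha]
      exact hcon a hab.symm
    · rw [Function.update_of_ne ha, Function.update_of_ne hb]
      exact hf a b ha hb hab

open Classical in
theorem shift {v w : V} {f : V → Fin k} (hf : PropOff G f v) (hu : Uniq G f v w) :
    PropOff G (Function.update f v (f w)) w := by
  intro a b ha hb hab
  have hne := hab.ne
  by_cases hav : a = v
  · subst hav
    rw [Function.update_self, Function.update_of_ne hne.symm]
    exact fun e => hb (hu b hab e.symm)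
  · by_cases hbv : b = v
    · subst hbv
      rw [Function.update_self, Function.update_of_ne hav]
      exact fun e => ha (hu a hab.symm e)
    · rw [Function.update_of_ne hav, Function.update_of_ne hbv]
      exact hf a b hav hbv hab

open Classical in
/-- counting lemma: colours in `A` appear on `N(p)`, colours of `B ⊆ A` at least twice. -/
theorem count_le {p : V} {f : V → Fin k} (A B : Finset (Fin k))
    (hBA : B ⊆ A)
    (hA : ∀ c ∈ A, ∃ w, G.Adj p w ∧ f w = c)
    (hB : ∀ c ∈ B, ∃ w w', w ≠ w' ∧ G.Adj p w ∧ G.Adj p w' ∧ f w = c ∧ f w' = c) :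
    A.card + B.card ≤ (nb G p).card := by
  have h1 : (nb G p).card = ∑ c : Fin k, ((nb G p).filter (fun u => f u = c)).card :=
    Finset.card_eq_sum_card_fiberwise (fun x _ => by simp)
  have h2 : A.card + B.card = ∑ c : Fin k, ((if c ∈ A then 1 else 0) + (if c ∈ B then 1 else 0)) := by
    rw [Finset.sum_add_distrib]; simp
  rw [h1, h2]
  apply Finset.sum_le_sum
  intro c _
  by_cases hcB : c ∈ B
  · obtain ⟨w, w', hne, h3, h4, h5, h6⟩ := hB c hcB
    have : 1 < ((nb G p).filter (fun u => f u = c)).card := by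
      rw [Finset.one_lt_card]
      exact ⟨w, by simp [mem_nb, *], w', by simp [mem_nb, *], hne⟩
    simp only [hcB, hBA hcB, if_true]; omega
  · by_cases hcA : c ∈ A
    · obtain ⟨w, h3, h4⟩ := hA c hcA
      have : 0 < ((nb G p).filter (fun u => f u = c)).card := by
        rw [Finset.card_pos]
        exact ⟨w, by simp [mem_nb, *]⟩
      simp only [hcB, hcA, if_true, if_false]; omega
    · simp [hcA, hcB]

open Classical in
/-- if one colour is repeated, all neighbours with another colour are unique. -/
theorem F3' (h : Crit G k) {v : V} {f : V → Fin k} (hf : PropOff G f v) {x x' y : V}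
    (hx : G.Adj v x) (hx' : G.Adj v x') (hne : x ≠ x') (hxx : f x = f x')
    (hy : f y ≠ f x) (hvy : G.Adj v y) : Uniq G f v y := by
  intro z hz hzy
  by_contra hzne
  have := count_le (G := G) (p := v) (f := f) Finset.univ {f x, f y} (by simp)
    (fun c _ => F1 h hf c) (by
      intro c hc
      simp only [Finset.mem_insert, Finset.mem_singleton] at hc
      rcases hc with rfl | rfl
      · exact ⟨x, x', hne, hx, hx', rfl, hxx.symm⟩
      · exact ⟨z, y, hzne, hz, hvy, hzy, rfl⟩)
  rw [Finset.card_pair hy.symm] at this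
  have h2 := h.hdeg v
  simp at this
  omega

theorem F3 (h : Crit G k) {v : V} {f : V → Fin k} (hf : PropOff G f v) :
    ∃ e : Fin k, ∀ x, G.Adj v x → f x ≠ e → Uniq G f v x := by
  by_cases hall : ∀ x, G.Adj v x → Uniq G f v x
  · exact ⟨⟨0, by have := h.hk; omega⟩, fun x hx _ => hall x hx⟩
  · push Not at hall
    obtain ⟨x, hx, hu⟩ := hall
    unfold Uniq at hu
    push Not at hu
    obtain ⟨y, hy, hyx, hne⟩ := hu
    exact ⟨f x, fun z hz hzx => F3' h hf hx hy (Ne.symm hne) hyx.symm hzx hz⟩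

open Classical in
theorem F4 (h : Crit G k) {v : V} {f : V → Fin k} (hf : PropOff G f v) {w w' : V}
    (hw : G.Adj v w) (hw' : G.Adj v w') (hu : Uniq G f v w) (hu' : Uniq G f v w')
    (hc : f w ≠ f w') (hn : ¬ G.Adj w w') :
    ∃ a b, a ≠ v ∧ b ≠ v ∧ f a = f w' ∧ f b = f w ∧ G.Adj w a ∧ G.Adj a b ∧ G.Adj b w' := by
  let N1 : V → Prop := fun a => a ≠ v ∧ f a = f w' ∧ G.Adj w a
  let N2 : V → Prop := fun b => b ≠ v ∧ f b = f w ∧ ∃ a, N1 a ∧ G.Adj a b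
  have hwv : w ≠ v := hw.ne'
  have hw'v : w' ≠ v := hw'.ne'
  by_cases hex : ∃ b d, N2 b ∧ d ≠ v ∧ f d = f w' ∧ ¬ N1 d ∧ G.Adj b d
  · obtain ⟨b, d, ⟨hbv, hbw, a, ⟨hav, haw, hwa⟩, hab⟩, hdv, hdw, hd1, hbd⟩ := hex
    refine ⟨a, b, hav, hbv, haw, hbw, hwa, hab, ?_⟩
    by_contra hbw'
    refine h.hp w a b d w' hwa hab hbd ?_ ?_ ?_ (fun e => hn e.symm) ?_ (fun e => hbw' e.symm) ?_
    · exact fun e => hf _ _ hwv hbv e hbw.symm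
    · exact fun e => hd1 ⟨hdv, hdw, e⟩
    · exact fun e => hf _ _ hav hdv e (haw.trans hdw.symm)
    · exact fun e => hf _ _ hw'v hav e haw.symm
    · exact fun e => hf _ _ hw'v hdv e hdw.symm
  · exfalso
    push Not at hex
    let X : V → Prop := fun u => u = w ∨ N1 u ∨ N2 u
    have key : ∀ u1 u2, u1 ≠ v → u2 ≠ v → G.Adj u1 u2 → X u1 → ¬ X u2 →
        Equiv.swap (f w) (f w') (f u1) ≠ f u2 := by
      intro u1 u2 h1 h2 h12 hx1 hx2 he
      rcases hx1 with rfl | h1' | h1'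
      · rw [Equiv.swap_apply_left] at he
        exact hx2 (Or.inr (Or.inl ⟨h2, he.symm, h12⟩))
      · rw [h1'.2.1, Equiv.swap_apply_right] at he
        exact hx2 (Or.inr (Or.inr ⟨h2, he.symm, u1, h1', h12⟩))
      · rw [h1'.2.1, Equiv.swap_apply_left] at he
        refine hex u1 u2 h1' h2 he.symm ?_ h12
        exact fun e => hx2 (Or.inr (Or.inl e))
    have hf' : PropOff G (fun u => if X u then Equiv.swap (f w) (f w') (f u) else f u) v := by
      intro a b ha hb hab
      by_cases hXa : X a <;> by_cases hXb : X b
      · simp only [hXa, hXb, if_true]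
        exact fun e => hf a b ha hb hab ((Equiv.swap _ _).injective e)
      · simp only [hXa, hXb, if_true, if_false]
        exact key a b ha hb hab hXa hXb
      · simp only [hXa, hXb, if_true, if_false]
        exact (key b a hb ha hab.symm hXb hXa).symm
      · simp only [hXa, hXb, if_false]
        exact hf a b ha hb hab
    obtain ⟨x, hx, hxc⟩ := F1 h hf' (f w)
    by_cases hXx : X x
    · simp only [hXx, if_true] at hxc
      have : f x = f w' := by
        rw [← Equiv.swap_apply_right (f w) (f w')] at hxc
        rw [Equiv.swap_apply_right] at hxc
        have := congrArg (Equiv.swap (f w) (f w')) hxc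
        rwa [Equiv.swap_apply_self, Equiv.swap_apply_left] at this
      have hxw' := hu' x hx this
      subst hxw'
      rcases hXx with h1 | h1 | h1
      · exact hc (by rw [h1])
      · exact hn h1.2.2
      · exact hc h1.2.1.symm
    · simp only [hXx, if_false] at hxc
      exact hXx (Or.inl (hu x hx hxc))

theorem F5 (h : Crit G k) {v : V} {f : V → Fin k} (hf : PropOff G f v) {w w' : V}
    (hw : G.Adj v w) (hw' : G.Adj v w') (hu : Uniq G f v w) (hu' : Uniq G f v w')
    (hc : f w ≠ f w') (hn : ¬ G.Adj w w') {u u' : V} (huv : u ≠ v) (huw : u ≠ w)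
    (hfu : f u = f w) (hu'v : u' ≠ v) (hfu' : f u' = f w') : G.Adj u u' := by
  obtain ⟨a, b, hav, hbv, haw, hbw, hwa, hab, hbw'⟩ := F4 h hf hw hw' hu hu' hc hn
  have hwv : w ≠ v := hw.ne'
  have hw'v : w' ≠ v := hw'.ne'
  have hn' : ¬ G.Adj w' w := fun e => hn e.symm
  have c0 : ∀ x y, x ≠ v → y ≠ v → f x = f w → f y = f w → ¬ G.Adj x y :=
    fun x y h1 h2 h3 h4 e => hf x y h1 h2 e (h3.trans h4.symm)
  have c1 : ∀ x y, x ≠ v → y ≠ v → f x = f w' → f y = f w' → ¬ G.Adj x y :=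
    fun x y h1 h2 h3 h4 e => hf x y h1 h2 e (h3.trans h4.symm)
  have hnwa : a ≠ w' := fun e => hn (e ▸ hwa)
  have hnwb : b ≠ w := fun e => hn (e ▸ hbw')
  have v0 : ∀ x, f x = f w → x ≠ w → ¬ G.Adj v x := fun x h1 h2 e => h2 (hu x e h1)
  have v1 : ∀ x, f x = f w' → x ≠ w' → ¬ G.Adj v x := fun x h1 h2 e => h2 (hu' x e h1)
  have v0' : ∀ x, f x = f w → x ≠ w → ¬ G.Adj x v := fun x h1 h2 e => h2 (hu x e.symm h1)
  have v1' : ∀ x, f x = f w' → x ≠ w' → ¬ G.Adj x v := fun x h1 h2 e => h2 (hu' x e.symm h1)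
  have huw' : G.Adj u w' := by
    by_cases hub : u = b
    · rw [hub]; exact hbw'
    by_contra hno
    exact h.hp b w' v w u hbw' hw'.symm hw (v0' b hbw hnwb) (c0 _ _ hbv hwv hbw rfl) hn'
      (c0 _ _ huv hbv hfu hbw) hno (v0' u hfu huw) (c0 _ _ huv hwv hfu rfl)
  have hua : G.Adj u a := by
    by_cases hub : u = b
    · rw [hub]; exact hab.symm
    by_contra hno
    exact h.hp v w a b u hw hwa hab (v1 a haw hnwa) (v0 b hbw hnwb) (c0 _ _ hwv hbv rfl hbw)
      (v0' u hfu huw) (c0 _ _ huv hwv hfu rfl) hno (c0 _ _ huv hbv hfu hbw)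
  by_cases h1 : u' = w'
  · rw [h1]; exact huw'
  by_cases h2 : u' = a
  · rw [h2]; exact hua
  have hu'b : G.Adj u' b := by
    by_contra hno
    exact h.hp v w' b a u' hw' hbw'.symm hab.symm (v0 b hbw hnwb) (v1 a haw hnwa)
      (c1 _ _ hw'v hav rfl haw)
      (v1' u' hfu' h1) (c1 _ _ hu'v hw'v hfu' rfl) hno (c1 _ _ hu'v hav hfu' haw)
  by_cases hub : u = b
  · rw [hub]; exact hu'b.symm
  by_contra hno
  exact h.hp u a b u' v hua hab hu'b.symm (c0 _ _ huv hbv hfu hbw) hno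
    (c1 _ _ hav hu'v haw hfu') (v0 u hfu huw) (v1 a haw hnwa) (v0 b hbw hnwb) (v1 u' hfu' h1)


open Classical in
/-- colours of unique neighbours of `v` not adjacent to `w`. -/
noncomputable def NJ (G : SimpleGraph V) (f : V → Fin k) (v w : V) : Finset (Fin k) :=
  Finset.univ.filter (fun c => ∃ x, G.Adj v x ∧ Uniq G f v x ∧ f x = c ∧ c ≠ f w ∧ ¬ G.Adj w x)

open Classical in
theorem NJ_card (h : Crit G k) {v : V} {f : V → Fin k} (hf : PropOff G f v) {w : V}
    (hw : G.Adj v w) (hu : Uniq G f v w) : (NJ G f v w).card ≤ 2 := by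
  by_contra hlt
  push Not at hlt
  have hwv : w ≠ v := hw.ne'
  have hmem : ∀ c ∈ NJ G f v w, ∃ x, G.Adj v x ∧ Uniq G f v x ∧ f x = c ∧ c ≠ f w ∧ ¬ G.Adj w x := by
    intro c hc
    simpa [NJ] using hc
  have hp : ∃ p, p ≠ v ∧ p ≠ w ∧ f p = f w ∧ ∀ c, c ≠ f w → ∃ y, G.Adj p y ∧ f y = c := by
    by_contra hcon
    push Not at hcon
    obtain ⟨c0, hc0⟩ := Finset.card_pos.mp (by omega : 0 < (NJ G f v w).card)
    obtain ⟨x0, hx0, hux0, hfx0, hne0, hnadj⟩ := hmem c0 hc0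
    have hm : ∀ p, ∃ c, (p ≠ v ∧ p ≠ w ∧ f p = f w) → c ≠ f w ∧ ∀ y, G.Adj p y → f y ≠ c := by
      intro p
      by_cases hpp : p ≠ v ∧ p ≠ w ∧ f p = f w
      · obtain ⟨c, h1, h2⟩ := hcon p hpp.1 hpp.2.1 hpp.2.2
        exact ⟨c, fun _ => ⟨h1, h2⟩⟩
      · exact ⟨f w, fun e => absurd e hpp⟩
    choose m hm using hm
    let P : V → Prop := fun p => p ≠ v ∧ p ≠ w ∧ f p = f w
    let g : V → Fin k := fun u => if P u then m u else f u
    have hgP : ∀ u, P u → g u = m u := fun u hP => if_pos hP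
    have hgN : ∀ u, ¬ P u → g u = f u := fun u hP => if_neg hP
    have hg : PropOff G g v := by
      intro a b ha hb hab
      by_cases hPa : P a <;> by_cases hPb : P b
      · exact absurd (hPa.2.2.trans hPb.2.2.symm) (hf a b ha hb hab)
      · rw [hgP a hPa, hgN b hPb]
        exact ((hm a hPa).2 b hab).symm
      · rw [hgN a hPa, hgP b hPb]
        exact (hm b hPb).2 a hab.symm
      · rw [hgN a hPa, hgN b hPb]
        exact hf a b ha hb hab
    have hnb : ∀ y, G.Adj v y → g y = f y := by
      intro y hy
      apply hgN
      intro hP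
      exact hP.2.1 (hu y hy hP.2.2)
    have hgu : ∀ x, G.Adj v x → Uniq G f v x → Uniq G g v x := by
      intro x hx hux y hy hyx
      rw [hnb y hy, hnb x hx] at hyx
      exact hux y hy hyx
    obtain ⟨a, b, hav, hbv, haw, hbw, hwa, hab, hbx⟩ :=
      F4 h hg hw hx0 (hgu w hw hu) (hgu x0 hx0 hux0)
        (by rw [hnb w hw, hnb x0 hx0, hfx0]; exact hne0.symm) hnadj
    have hbnw : b ≠ w := fun e => hnadj (e ▸ hbx)
    rw [hnb w hw] at hbw
    by_cases hPb : P b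
    · rw [hgP b hPb] at hbw
      exact (hm b hPb).1 hbw
    · rw [hgN b hPb] at hbw
      exact hPb ⟨hbv, hbnw, hbw⟩
  obtain ⟨p, hpv, hpw, hfp, hsee⟩ := hp
  have := count_le (G := G) (p := p) (f := f) (Finset.univ.erase (f w)) (NJ G f v w)
    (by
      intro c hc
      obtain ⟨x, _, _, _, hne, _⟩ := hmem c hc
      simp [hne])
    (by
      intro c hc
      exact hsee c (by simpa using hc))
    (by
      intro c hc
      obtain ⟨x, hx, hux, hfx, hne, hna⟩ := hmem c hc
      have hcc : f w ≠ f x := by rw [hfx]; exact hne.symm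
      obtain ⟨a, b, hav, hbv, haw, hbw, hwa, hab, hbx⟩ := F4 h hf hw hx hu hux hcc hna
      refine ⟨x, a, fun e => hna (e ▸ hwa), ?_, ?_, hfx, haw.trans hfx⟩
      · exact F5 h hf hw hx hu hux hcc hna hpv hpw hfp hx.ne' rfl
      · exact F5 h hf hw hx hu hux hcc hna hpv hpw hfp hav haw)
  rw [Finset.card_erase_of_mem (Finset.mem_univ _), Finset.card_univ, Fintype.card_fin] at this
  have h2 := h.hdeg p
  have := h.hk
  omega

open Classical in
theorem fin3 (h : Crit G k) {v : V} {f : V → Fin k} (hf : PropOff G f v) {w1 w2 wc : V}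
    (h1 : G.Adj v w1) (h2 : G.Adj v w2) (h3 : G.Adj v wc)
    (u1 : Uniq G f v w1)
    (n12 : f w1 ≠ f w2) (n1c : f w1 ≠ f wc) (n2c : f w2 ≠ f wc)
    (hn : ¬ G.Adj w1 w2)
    (q1 : ∀ u, u ≠ v → f u = f wc → G.Adj w1 u → u = wc)
    (q2 : ∀ u, u ≠ v → f u = f wc → G.Adj w2 u → u = wc)
    (qc : ∀ u, u ≠ v → f u = f w2 → G.Adj wc u → u = w2) : False := by
  have v1 : w1 ≠ v := h1.ne'
  have v2 : w2 ≠ v := h2.ne'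
  have v3 : wc ≠ v := h3.ne'
  let S1 : V → Prop := fun u => u ≠ v ∧ (u = w1 ∨ u = w2 ∨ (f u = f wc ∧ u ≠ wc))
  let S2 : V → Prop := fun u => u = v ∨ (f u = f w1 ∧ u ≠ w1)
  let S3 : V → Prop := fun u => u ≠ v ∧ (u = wc ∨ (f u = f w2 ∧ u ≠ w2))
  have i1 : ∀ a b, S1 a → S1 b → ¬ G.Adj a b := by
    rintro a b ⟨hav, ha⟩ ⟨hbv, hb⟩ hab
    have := hf a b hav hbv hab
    have hab' := hab.symm
    have := hab.ne
    grind
  have i2 : ∀ a b, S2 a → S2 b → ¬ G.Adj a b := by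
    rintro a b ha hb hab
    rcases ha with rfl | ⟨ha, ha'⟩
    · rcases hb with rfl | ⟨hb, hb'⟩
      · exact hab.ne rfl
      · exact hb' (u1 b hab hb)
    · by_cases hbv : b = v
      · subst hbv
        exact ha' (u1 a hab.symm ha)
      · by_cases hav : a = v
        · subst hav
          exact (hb.resolve_left hbv).2 (u1 b hab (hb.resolve_left hbv).1)
        · exact hf a b hav hbv hab (ha.trans (hb.resolve_left hbv).1.symm)
  have i3 : ∀ a b, S3 a → S3 b → ¬ G.Adj a b := by
    rintro a b ⟨hav, ha⟩ ⟨hbv, hb⟩ hab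
    have := hf a b hav hbv hab
    have hab' := hab.symm
    have := hab.ne
    grind
  let g : V → Fin k := fun u => if S1 u then f w1 else if S2 u then f w2 else if S3 u then f wc
    else f u
  have r1 : ∀ u, S1 u → g u = f w1 := fun u hu => if_pos hu
  have hg : ∀ u, (S1 u ∧ g u = f w1) ∨ (S2 u ∧ g u = f w2) ∨ (S3 u ∧ g u = f wc) ∨
      (u ≠ v ∧ g u = f u ∧ f u ≠ f w1 ∧ f u ≠ f w2 ∧ f u ≠ f wc) := by
    intro u
    simp only [g]
    by_cases c1 : S1 u
    · left; exact ⟨c1, if_pos c1⟩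
    by_cases c2 : S2 u
    · right; left; exact ⟨c2, by rw [if_neg c1, if_pos c2]⟩
    by_cases c3 : S3 u
    · right; right; left; exact ⟨c3, by rw [if_neg c1, if_neg c2, if_pos c3]⟩
    · right; right; right
      rw [if_neg c1, if_neg c2, if_neg c3]
      simp only [S1, S2, S3] at c1 c2 c3
      grind
  apply h.hnc g
  intro a b hab
  have j0 := hf a b
  have j1 := i1 a b
  have j2 := i2 a b
  have j3 := i3 a b
  have hga := hg a
  have hgb := hg b
  clear_value g S1 S2 S3
  rcases hga with ⟨p, q⟩ | ⟨p, q⟩ | ⟨p, q⟩ | ⟨p, q, r, s, t⟩ <;>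
  rcases hgb with ⟨p', q'⟩ | ⟨p', q'⟩ | ⟨p', q'⟩ | ⟨p', q', r', s', t'⟩ <;>
  rw [q, q'] <;> first | assumption | (exact Ne.symm (by assumption)) |
    exact absurd hab (j1 p p') | exact absurd hab (j2 p p') | exact absurd hab (j3 p p') |
    exact j0 p p' hab

open Classical in
theorem helper {v x y : V} {f : V → Fin k} {e : Fin k}
    (he : ∀ z, G.Adj x z → Function.update f v (f x) z ≠ e →
      Uniq G (Function.update f v (f x)) x z)
    (hxy : G.Adj x y) (hyv : y ≠ v) (hye : f y ≠ e) (u : V) (huv : u ≠ v) (hfu : f u = f y)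
    (hxu : G.Adj x u) : u = y := by
  have := he y hxy (by rwa [Function.update_of_ne hyv]) u hxu
  rw [Function.update_of_ne hyv, Function.update_of_ne huv] at this
  exact this hfu

open Classical in
/-- Part 1: the unique neighbours of `v` form a clique. -/
theorem star (h : Crit G k) {v : V} {f : V → Fin k} (hf : PropOff G f v) {w1 w2 : V}
    (h1 : G.Adj v w1) (h2 : G.Adj v w2) (u1 : Uniq G f v w1) (u2 : Uniq G f v w2)
    (hne : w1 ≠ w2) : G.Adj w1 w2 := by
  by_contra hn
  have hc : f w1 ≠ f w2 := fun e => hne (u2 w1 h1 e)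
  have hn' : ¬ G.Adj w2 w1 := fun e => hn e.symm
  obtain ⟨e, he⟩ := F3 h hf
  obtain ⟨e1, he1⟩ := F3 h (shift hf u1)
  obtain ⟨e2, he2⟩ := F3 h (shift hf u2)
  have j1 := NJ_card h hf h1 u1
  have j2 := NJ_card h hf h2 u2
  have hcard : (({e, e1, e2} : Finset (Fin k)) ∪ NJ G f v w1 ∪ NJ G f v w2).card ≤ 7 := by
    have a1 := Finset.card_union_le (({e, e1, e2} : Finset (Fin k)) ∪ NJ G f v w1) (NJ G f v w2)
    have a2 := Finset.card_union_le ({e, e1, e2} : Finset (Fin k)) (NJ G f v w1)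
    have a3 := Finset.card_le_three (a := e) (b := e1) (c := e2)
    omega
  have hlt : (({e, e1, e2} : Finset (Fin k)) ∪ NJ G f v w1 ∪ NJ G f v w2).card <
      (Finset.univ : Finset (Fin k)).card := by
    rw [Finset.card_univ, Fintype.card_fin]; have := h.hk; omega
  obtain ⟨c, -, hcn⟩ := Finset.exists_mem_notMem_of_card_lt_card hlt
  simp only [Finset.mem_union, Finset.mem_insert, Finset.mem_singleton, not_or] at hcn
  obtain ⟨⟨⟨ce, ce1, ce2⟩, cj1⟩, cj2⟩ := hcn
  obtain ⟨wc, hwc, rfl⟩ := F1 h hf c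
  have uc := he wc hwc ce
  have m1 : f wc ≠ f w1 := by
    intro e
    apply cj2
    simp only [NJ, Finset.mem_filter, Finset.mem_univ, true_and]
    exact ⟨w1, h1, u1, e.symm, by rw [e]; exact hc, hn'⟩
  have m2 : f wc ≠ f w2 := by
    intro e
    apply cj1
    simp only [NJ, Finset.mem_filter, Finset.mem_univ, true_and]
    exact ⟨w2, h2, u2, e.symm, by rw [e]; exact hc.symm, hn⟩
  have a1 : G.Adj w1 wc := by
    by_contra hno
    apply cj1
    simp only [NJ, Finset.mem_filter, Finset.mem_univ, true_and]
    exact ⟨wc, hwc, uc, rfl, m1, hno⟩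
  have a2 : G.Adj w2 wc := by
    by_contra hno
    apply cj2
    simp only [NJ, Finset.mem_filter, Finset.mem_univ, true_and]
    exact ⟨wc, hwc, uc, rfl, m2, hno⟩
  obtain ⟨ec, hec⟩ := F3 h (shift hf uc)
  have q1 := helper he1 a1 hwc.ne' ce1
  have q2 := helper he2 a2 hwc.ne' ce2
  by_cases h2c : f w2 = ec
  · have h1c : f w1 ≠ ec := by rw [← h2c]; exact hc
    exact fin3 h hf h2 h1 hwc u2 hc.symm m2.symm m1.symm hn' q2 q1
      (helper hec a1.symm h1.ne' h1c)
  · exact fin3 h hf h1 h2 hwc u1 hc m1.symm m2.symm hn q1 q2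
      (helper hec a2.symm h2.ne' h2c)


theorem exists_avoid (hk : 8 ≤ k) (F : Finset (Fin k)) (hF : F.card ≤ 7) : ∃ c, c ∉ F := by
  by_contra hcon
  push Not at hcon
  have : F = Finset.univ := Finset.eq_univ_of_forall hcon
  rw [this, Finset.card_univ, Fintype.card_fin] at hF
  omega

open Classical in
theorem out_card (h : Crit G k) {R : Finset V} {m : ℕ} (hR : R.card + m = k + 1) {x : V}
    (hx : ∀ r ∈ R, G.Adj x r) : (nb G x \ R).card ≤ m := by
  have hsub : R ⊆ nb G x := fun r hr => mem_nb.mpr (hx r hr)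
  have h1 := Finset.card_sdiff_add_card_eq_card hsub
  have h2 := h.hdeg x
  omega

open Classical in
/-- `K_{k-1} ∨ E_2`: one can choose a colouring in which `q` and `s` agree. -/
theorem caseA_same (h : Crit G k) {R : Finset V} (hR : R.card + 1 = k)
    (hRc : ∀ a ∈ R, ∀ b ∈ R, a ≠ b → G.Adj a b) {q s : V} (hqR : q ∉ R) (hsR : s ∉ R)
    (hqs : q ≠ s) (hq : ∀ r ∈ R, G.Adj q r) (hs : ∀ r ∈ R, G.Adj s r) (hn : ¬ G.Adj q s) :
    ∃ v ∈ R, ∃ f : V → Fin k, PropOff G f v ∧ f q = f s := by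
  have hk := h.hk
  obtain ⟨v, hv⟩ := Finset.card_pos.mp (by omega : 0 < R.card)
  obtain ⟨f, hf⟩ := h.hcrit v
  by_cases hfe : f q = f s
  · exact ⟨v, hv, f, hf, hfe⟩
  have hqv : q ≠ v := fun e => hqR (e ▸ hv)
  have hsv : s ≠ v := fun e => hsR (e ▸ hv)
  have oq := out_card h (m := 2) (by omega) hq
  have os := out_card h (m := 2) (by omega) hs
  have hcardF : ((nb G q \ R).image f ∪ (nb G s \ R).image f ∪ {f q, f s}).card ≤ 7 := by
    have a1 := Finset.card_union_le ((nb G q \ R).image f ∪ (nb G s \ R).image f) {f q, f s}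
    have a2 := Finset.card_union_le ((nb G q \ R).image f) ((nb G s \ R).image f)
    have a3 := Finset.card_image_le (s := nb G q \ R) (f := f)
    have a4 := Finset.card_image_le (s := nb G s \ R) (f := f)
    have a5 := Finset.card_le_two (a := f q) (b := f s)
    omega
  obtain ⟨c, hc⟩ := exists_avoid hk _ hcardF
  simp only [Finset.mem_union, Finset.mem_image, Finset.mem_insert, Finset.mem_singleton,
    not_or, not_exists, not_and, Finset.mem_sdiff, mem_nb] at hc
  obtain ⟨⟨hcq, hcs⟩, hcfq, hcfs⟩ := hc
  have hfR : ∀ a ∈ R, ∀ b ∈ R, a ≠ v → b ≠ v → a ≠ b → f a ≠ f b :=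
    fun a ha b hb h1 h2 h3 => hf a b h1 h2 (hRc a ha b hb h3)
  have hfq : ∀ a ∈ R, a ≠ v → f q ≠ f a := fun a ha h1 => hf q a hqv h1 (hq a ha)
  have hfs : ∀ a ∈ R, a ≠ v → f s ≠ f a := fun a ha h1 => hf s a hsv h1 (hs a ha)
  let T : Finset V := insert q (insert s (R.erase v))
  have hTcard : T.card = k := by
    rw [Finset.card_insert_of_notMem, Finset.card_insert_of_notMem, Finset.card_erase_of_mem hv]
    · omega
    · simp [hsR]
    · simp [hqR, hqs]
  have hinj : Set.InjOn f T := by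
    intro a ha b hb hab
    simp only [T, Finset.coe_insert, Finset.coe_erase, Set.mem_insert_iff, Set.mem_sdiff,
      Finset.mem_coe, Set.mem_singleton_iff] at ha hb
    by_contra hne
    rcases ha with rfl | rfl | ⟨ha, ha'⟩ <;> rcases hb with rfl | rfl | ⟨hb, hb'⟩
    · exact hne rfl
    · exact hfe hab
    · exact hfq b hb hb' hab
    · exact hfe hab.symm
    · exact hne rfl
    · exact hfs b hb hb' hab
    · exact hfq a ha ha' hab.symm
    · exact hfs a ha ha' hab.symm
    · exact hfR a ha b hb ha' hb' hne hab
  have himg : T.image f = Finset.univ := by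
    apply Finset.eq_univ_of_card
    rw [Finset.card_image_of_injOn hinj, hTcard, Fintype.card_fin]
  have hcT : c ∈ T.image f := by rw [himg]; simp
  obtain ⟨u, huT, huc⟩ := Finset.mem_image.mp hcT
  have huR : u ∈ R ∧ u ≠ v := by
    simp only [T, Finset.mem_insert, Finset.mem_erase] at huT
    rcases huT with rfl | rfl | ⟨h1, h2⟩
    · exact absurd huc.symm hcfq
    · exact absurd huc.symm hcfs
    · exact ⟨h2, h1⟩
  have oT : (nb G v \ T).card ≤ 1 := by
    apply out_card h (by omega)
    intro r hr
    simp only [T, Finset.mem_insert, Finset.mem_erase] at hr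
    rcases hr with rfl | rfl | ⟨h1, h2⟩
    · exact (hq v hv).symm
    · exact (hs v hv).symm
    · exact hRc v hv r h2 h1.symm
  have hγ : ∃ γ, (γ = f q ∨ γ = f s) ∧ ∀ z ∈ nb G v \ T, f z ≠ γ := by
    by_cases hz : ∃ z ∈ nb G v \ T, f z = f q
    · obtain ⟨z, hz, hzq⟩ := hz
      refine ⟨f s, Or.inr rfl, fun y hy hys => hfe ?_⟩
      have : y = z := Finset.card_le_one.mp oT y hy z hz
      rw [← hzq, ← this, hys]
    · push Not at hz
      exact ⟨f q, Or.inl rfl, hz⟩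
  obtain ⟨γ, hγ1, hγ2⟩ := hγ
  have hcγ : c ≠ γ := by rcases hγ1 with rfl | rfl <;> assumption
  let g : V → Fin k := fun x => if x = q ∨ x = s then c else if x = v then γ else f x
  have hg : ∀ x, ((x = q ∨ x = s) ∧ g x = c) ∨ (x = v ∧ g x = γ) ∨
      (x ≠ q ∧ x ≠ s ∧ x ≠ v ∧ g x = f x) := by
    intro x
    by_cases h1 : x = q ∨ x = s
    · left; exact ⟨h1, if_pos h1⟩
    · by_cases h2 : x = v
      · right; left; exact ⟨h2, by simp only [g]; rw [if_neg h1, if_pos h2]⟩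
      · right; right
        push Not at h1
        exact ⟨h1.1, h1.2, h2, by simp [g, h1.1, h1.2, h2]⟩
  have k1 : ∀ x, (x = q ∨ x = s) → ∀ b, b ≠ u → b ≠ v → G.Adj x b → f b ≠ c := by
    intro x hx b hbu hbv hxb
    by_cases hbR : b ∈ R
    · rw [← huc]; exact hfR b hbR u huR.1 hbv huR.2 hbu
    · rcases hx with rfl | rfl
      · exact hcq b ⟨hxb, hbR⟩
      · exact hcs b ⟨hxb, hbR⟩
  have k2 : ∀ b, b ≠ q → b ≠ s → b ≠ v → G.Adj v b → f b ≠ γ := by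
    intro b hbq hbs hbv hvb
    by_cases hbT : b ∈ T
    · have hbR : b ∈ R := by
        simp only [T, Finset.mem_insert, Finset.mem_erase] at hbT
        tauto
      rcases hγ1 with rfl | rfl
      · exact (hfq b hbR hbv).symm
      · exact (hfs b hbR hbv).symm
    · exact hγ2 b (by simp [mem_nb, hvb, hbT])
  have k3 : ∀ x y, (x = q ∨ x = s) → (y = q ∨ y = s) → ¬ G.Adj x y := by
    rintro x y (rfl | rfl) (rfl | rfl) hxy
    · exact hxy.ne rfl
    · exact hn hxy
    · exact hn hxy.symm
    · exact hxy.ne rfl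
  refine ⟨u, huR.1, g, ?_, ?_⟩
  · intro a b hau hbu hab
    rcases hg a with ⟨p, r⟩ | ⟨p, r⟩ | ⟨p1, p2, p3, r⟩ <;>
    rcases hg b with ⟨p', r'⟩ | ⟨p', r'⟩ | ⟨p1', p2', p3', r'⟩ <;> rw [r, r']
    · exact absurd hab (k3 a b p p')
    · exact hcγ
    · exact (k1 a p b hbu p3' hab).symm
    · exact hcγ.symm
    · exact absurd (p.trans p'.symm) hab.ne
    · subst p; exact (k2 b p1' p2' p3' hab).symm
    · exact k1 b p' a hau p3 hab.symm
    · subst p'; exact k2 a p1 p2 p3 hab.symm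
    · exact hf a b p3 p3' hab
  · simp [g]

open Classical in
/-- no `K_{k-1} ∨ E_2`. -/
theorem caseA (h : Crit G k) {R : Finset V} (hR : R.card + 1 = k)
    (hRc : ∀ a ∈ R, ∀ b ∈ R, a ≠ b → G.Adj a b) {q s : V} (hqR : q ∉ R) (hsR : s ∉ R)
    (hqs : q ≠ s) (hq : ∀ r ∈ R, G.Adj q r) (hs : ∀ r ∈ R, G.Adj s r) (hn : ¬ G.Adj q s) :
    False := by
  have hk := h.hk
  obtain ⟨v, hv, f, hf, hfe⟩ := caseA_same h hR hRc hqR hsR hqs hq hs hn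
  have hqv : q ≠ v := fun e => hqR (e ▸ hv)
  have hsv : s ≠ v := fun e => hsR (e ▸ hv)
  have hlt : ((insert q (R.erase v)).image f).card < (Finset.univ : Finset (Fin k)).card := by
    have a1 := Finset.card_image_le (s := insert q (R.erase v)) (f := f)
    have a2 := Finset.card_insert_le q (R.erase v)
    rw [Finset.card_erase_of_mem hv] at a2
    rw [Finset.card_univ, Fintype.card_fin]
    omega
  obtain ⟨γ, -, hγ⟩ := Finset.exists_mem_notMem_of_card_lt_card hlt
  obtain ⟨z, hvz, rfl⟩ := F1 h hf γ
  simp only [Finset.mem_image, Finset.mem_insert, Finset.mem_erase, not_exists, not_and] at hγ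
  have hzq : f z ≠ f q := fun e => hγ q (Or.inl rfl) e.symm
  have hzR : z ∉ R := fun e => hγ z (Or.inr ⟨hvz.ne', e⟩) rfl
  have hznq : z ≠ q := fun e => hzq (by rw [e])
  have hzns : z ≠ s := fun e => hzq (by rw [e, hfe])
  have hzadj : ∀ r ∈ R, G.Adj z r := by
    intro r hr
    by_cases hrv : r = v
    · rw [hrv]; exact hvz.symm
    have hvr : G.Adj v r := hRc v hv r hr (Ne.symm hrv)
    have uz := F3' h hf (hq v hv).symm (hs v hv).symm hqs hfe hzq hvz
    have ur := F3' h hf (hq v hv).symm (hs v hv).symm hqs hfe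
      (hf q r hqv hrv (hq r hr)).symm hvr
    exact star h hf hvz hvr uz ur (fun e => hzR (e ▸ hr))
  have noK : ∀ x, x ∉ R → z ≠ x → (∀ r ∈ R, G.Adj x r) → ¬ G.Adj z x := by
    intro x hxR hzx hx hadj
    have := h.hcl (insert z (insert x R)) (by
      intro a ha b hb hab
      simp only [Finset.mem_insert] at ha hb
      rcases ha with rfl | rfl | ha <;> rcases hb with rfl | rfl | hb
      · exact absurd rfl hab
      · exact hadj
      · exact hzadj b hb
      · exact hadj.symm
      · exact absurd rfl hab
      · exact hx b hb
      · exact (hzadj a ha).symm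
      · exact (hx a ha).symm
      · exact hRc a ha b hb hab)
    rw [Finset.card_insert_of_notMem (by simp [hzx, hzR]), Finset.card_insert_of_notMem hxR] at this
    omega
  have nzq := noK q hqR hznq hq
  have nzs := noK s hsR hzns hs
  have hN : ∀ u ∈ R, ∀ y, G.Adj u y → y ∈ R ∨ y = q ∨ y = s ∨ y = z := by
    intro u hu y huy
    by_contra hcon
    push Not at hcon
    obtain ⟨c1, c2, c3, c4⟩ := hcon
    have hsub : insert y (insert q (insert s (insert z (R.erase u)))) ⊆ nb G u := by
      intro x hx
      simp only [Finset.mem_insert, Finset.mem_erase] at hx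
      rw [mem_nb]
      rcases hx with rfl | rfl | rfl | rfl | ⟨h1, h2⟩
      · exact huy
      · exact (hq u hu).symm
      · exact (hs u hu).symm
      · exact (hzadj u hu).symm
      · exact hRc u hu x h2 h1.symm
    have := Finset.card_le_card hsub
    rw [Finset.card_insert_of_notMem (by simp [c1, c2, c3, c4]),
      Finset.card_insert_of_notMem (by simp [hqs, hznq.symm, hqR]),
      Finset.card_insert_of_notMem (by simp [hzns.symm, hsR]),
      Finset.card_insert_of_notMem (by simp [hzR]), Finset.card_erase_of_mem hu] at this
    have := h.hdeg u
    omega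
  have oq := out_card h (m := 2) (by omega) hq
  have os := out_card h (m := 2) (by omega) hs
  have oz := out_card h (m := 2) (by omega) hzadj
  have hcardF : ((nb G q \ R).image f ∪ (nb G s \ R).image f ∪ (nb G z \ R).image f).card ≤ 7 := by
    have a1 := Finset.card_union_le ((nb G q \ R).image f ∪ (nb G s \ R).image f)
      ((nb G z \ R).image f)
    have a2 := Finset.card_union_le ((nb G q \ R).image f) ((nb G s \ R).image f)
    have a3 := Finset.card_image_le (s := nb G q \ R) (f := f)
    have a4 := Finset.card_image_le (s := nb G s \ R) (f := f)
    have a5 := Finset.card_image_le (s := nb G z \ R) (f := f)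
    omega
  obtain ⟨c, hc⟩ := exists_avoid hk _ hcardF
  simp only [Finset.mem_union, Finset.mem_image,
    not_or, not_exists, not_and, Finset.mem_sdiff, mem_nb] at hc
  obtain ⟨⟨hcq, hcs⟩, hcz⟩ := hc
  have hcardE : R.card = (Finset.univ.erase c : Finset (Fin k)).card := by
    rw [Finset.card_erase_of_mem (Finset.mem_univ _), Finset.card_univ, Fintype.card_fin]; omega
  let E := Finset.equivOfCardEq hcardE
  have hE : ∀ x : R, (E x : Fin k) ≠ c := fun x => (Finset.mem_erase.mp (E x).2).1
  let P : V → Prop := fun x => x = q ∨ x = s ∨ x = z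
  have hPR : ∀ x, P x → x ∉ R := by
    rintro x (rfl | rfl | rfl) <;> assumption
  have hPP : ∀ x y, P x → P y → ¬ G.Adj x y := by
    rintro x y (rfl | rfl | rfl) (rfl | rfl | rfl) hxy
    · exact hxy.ne rfl
    · exact hn hxy
    · exact nzq hxy.symm
    · exact hn hxy.symm
    · exact hxy.ne rfl
    · exact nzs hxy.symm
    · exact nzq hxy
    · exact nzs hxy
    · exact hxy.ne rfl
  have hPo : ∀ x y, P x → y ∉ R → G.Adj x y → f y ≠ c := by
    rintro x y (rfl | rfl | rfl) hy hxy
    · exact hcq y ⟨hxy, hy⟩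
    · exact hcs y ⟨hxy, hy⟩
    · exact hcz y ⟨hxy, hy⟩
  have hRo : ∀ x ∈ R, ∀ y, y ∉ R → ¬ P y → ¬ G.Adj x y := by
    intro x hx y hy hPy hxy
    rcases hN x hx y hxy with h1 | h1
    · exact hy h1
    · exact hPy h1
  let g : V → Fin k := fun x => if hx : x ∈ R then (E ⟨x, hx⟩ : Fin k) else if P x then c else f x
  have g1 : ∀ x (hx : x ∈ R), g x = E ⟨x, hx⟩ := fun x hx => dif_pos hx
  have g2 : ∀ x, x ∉ R → P x → g x = c := fun x hx hP => by simp only [g]; rw [dif_neg hx, if_pos hP]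
  have g3 : ∀ x, x ∉ R → ¬ P x → g x = f x :=
    fun x hx hP => by simp only [g]; rw [dif_neg hx, if_neg hP]
  apply h.hnc g
  intro a b hab
  by_cases ha : a ∈ R <;> by_cases hb : b ∈ R
  · rw [g1 a ha, g1 b hb]
    intro e
    have := E.injective (Subtype.ext e)
    exact hab.ne (congrArg Subtype.val this)
  · by_cases hPb : P b
    · rw [g1 a ha, g2 b hb hPb]; exact hE _
    · exact absurd hab (hRo a ha b hb hPb)
  · by_cases hPa : P a
    · rw [g1 b hb, g2 a ha hPa]; exact (hE _).symm
    · exact absurd hab.symm (hRo b hb a ha hPa)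
  · by_cases hPa : P a <;> by_cases hPb : P b
    · exact absurd hab (hPP a b hPa hPb)
    · rw [g2 a ha hPa, g3 b hb hPb]; exact (hPo a b hPa hb hab).symm
    · rw [g3 a ha hPa, g2 b hb hPb]; exact hPo b a hPb ha hab.symm
    · rw [g3 a ha hPa, g3 b hb hPb]
      exact hf a b (fun e => ha (e ▸ hv)) (fun e => hb (e ▸ hv)) hab

open Classical in
theorem caseA' (h : Crit G k) {Q : Finset V} (hQ : Q.card = k)
    (hQc : ∀ a ∈ Q, ∀ b ∈ Q, a ≠ b → G.Adj a b) {q s : V} (hq : q ∈ Q) (hs : s ∉ Q)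
    (hadj : ∀ r ∈ Q, r ≠ q → G.Adj s r) : False := by
  have hk := h.hk
  have hsq : s ≠ q := fun e => hs (e ▸ hq)
  refine caseA h (R := Q.erase q) (q := q) (s := s) ?_ ?_ ?_ ?_ hsq.symm ?_ ?_ ?_
  · rw [Finset.card_erase_of_mem hq]; omega
  · intro a ha b hb
    exact hQc a (Finset.mem_of_mem_erase ha) b (Finset.mem_of_mem_erase hb)
  · simp
  · simp [hs]
  · intro r hr
    rw [Finset.mem_erase] at hr
    exact hQc q hq r hr.2 hr.1.symm
  · intro r hr
    rw [Finset.mem_erase] at hr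
    exact hadj r hr.2 hr.1
  · intro hqs
    have hall : ∀ r ∈ Q, G.Adj s r := by
      intro r hr
      by_cases e : r = q
      · rw [e]; exact hqs.symm
      · exact hadj r hr e
    have := h.hcl (insert s Q) (by
      intro a ha b hb hab
      simp only [Finset.mem_insert] at ha hb
      rcases ha with rfl | ha <;> rcases hb with rfl | hb
      · exact absurd rfl hab
      · exact hall b hb
      · exact (hall a ha).symm
      · exact hQc a ha b hb hab)
    rw [Finset.card_insert_of_notMem hs] at this
    omega


/-- a `k`-clique through the uncoloured vertex, whose outside neighbours all have colour `e`. -/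
structure Conf (G : SimpleGraph V) (v : V) (f : V → Fin k) (e : Fin k) (Q : Finset V) : Prop where
  hf : PropOff G f v
  hv : v ∈ Q
  hcard : Q.card = k
  hcl : ∀ a ∈ Q, ∀ b ∈ Q, a ≠ b → G.Adj a b
  hout : ∀ u ∈ Q, ∀ z, z ∉ Q → G.Adj u z → f z = e
  hin : ∀ u ∈ Q, u ≠ v → f u ≠ e

open Classical in
theorem Conf.shift {v u : V} {f : V → Fin k} {e : Fin k} {Q : Finset V} (C : Conf G v f e Q)
    (hu : u ∈ Q) : ∃ f' : V → Fin k, Conf G u f' e Q := by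
  by_cases huv : u = v
  · subst huv; exact ⟨f, C⟩
  have hU : Uniq G f v u := by
    intro y hy hyu
    by_cases hyQ : y ∈ Q
    · by_contra hne
      exact C.hf y u hy.ne' huv (C.hcl y hyQ u hu hne) hyu
    · exact absurd (hyu.symm.trans (C.hout v C.hv y hyQ hy)) (C.hin u hu huv)
  refine ⟨Function.update f v (f u), BK.shift C.hf hU, hu, C.hcard, C.hcl, ?_, ?_⟩
  · intro a ha z hz haz
    rw [Function.update_of_ne (fun (hh : z = v) => hz (hh ▸ C.hv))]
    exact C.hout a ha z hz haz
  · intro a ha hau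
    by_cases hav : a = v
    · subst hav; rw [Function.update_self]; exact C.hin u hu huv
    · rw [Function.update_of_ne hav]; exact C.hin a ha hav

open Classical in
theorem conf_exists (h : Crit G k) : ∃ (v : V) (f : V → Fin k) (e : Fin k) (Q : Finset V),
    Conf G v f e Q := by
  have hk := h.hk
  have hne : Nonempty V := by
    by_contra hn
    exact h.hnc (fun v => absurd ⟨v⟩ hn) (fun a => absurd ⟨a⟩ hn)
  obtain ⟨v⟩ := hne
  obtain ⟨f, hf⟩ := h.hcrit v
  obtain ⟨e, he⟩ := F3 h hf
  let S : Finset V := (nb G v).filter (fun x => f x ≠ e)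
  have hS : ∀ x, x ∈ S ↔ G.Adj v x ∧ f x ≠ e := by
    intro x; simp [S, mem_nb]
  have hvS : v ∉ S := fun hh => ((hS v).mp hh).1.ne rfl
  have himg : S.image f = Finset.univ.erase e := by
    ext c
    simp only [Finset.mem_image, hS, Finset.mem_erase, Finset.mem_univ, and_true]
    constructor
    · rintro ⟨x, ⟨_, hx⟩, rfl⟩; exact hx
    · intro hc
      obtain ⟨w, hw, rfl⟩ := F1 h hf c
      exact ⟨w, ⟨hw, hc⟩, rfl⟩
  have hinj : Set.InjOn f S := by
    intro a ha b hb hab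
    have ha' := (hS a).mp ha
    have hb' := (hS b).mp hb
    exact he b hb'.1 hb'.2 a ha'.1 hab
  have hScard : S.card = k - 1 := by
    rw [← Finset.card_image_of_injOn hinj, himg, Finset.card_erase_of_mem (Finset.mem_univ _),
      Finset.card_univ, Fintype.card_fin]
  have hQcard : (insert v S).card = k := by
    rw [Finset.card_insert_of_notMem hvS, hScard]; omega
  have hQcl : ∀ a ∈ insert v S, ∀ b ∈ insert v S, a ≠ b → G.Adj a b := by
    intro a ha b hb hab
    simp only [Finset.mem_insert, hS] at ha hb
    rcases ha with rfl | ha <;> rcases hb with rfl | hb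
    · exact absurd rfl hab
    · exact hb.1
    · exact ha.1.symm
    · exact star h hf ha.1 hb.1 (he a ha.1 ha.2) (he b hb.1 hb.2) hab
  have hin : ∀ u ∈ insert v S, u ≠ v → f u ≠ e := by
    intro u hu huv
    exact ((hS u).mp ((Finset.mem_insert.mp hu).resolve_left huv)).2
  refine ⟨v, f, e, insert v S, hf, by simp, hQcard, hQcl, ?_, hin⟩
  intro u hu z hz huz
  by_contra hze
  have hzv : z ≠ v := fun hh => hz (by simp [hh])
  have hzS : z ∉ S := fun hh => hz (by simp [hh])
  by_cases huv : u = v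
  · subst huv; exact hzS ((hS z).mpr ⟨huz, hze⟩)
  have huS : u ∈ S := (Finset.mem_insert.mp hu).resolve_left huv
  have huS' := (hS u).mp huS
  have hf' := BK.shift hf (he u huS'.1 huS'.2)
  have gne : ∀ x, x ≠ v → Function.update f v (f u) x = f x :=
    fun x hx => Function.update_of_ne hx _ _
  obtain ⟨z0, huz0, hz0⟩ := F1 h hf' e
  have hz0v : z0 ≠ v := by
    intro hh
    rw [hh, Function.update_self] at hz0
    exact huS'.2 hz0
  rw [gne z0 hz0v] at hz0
  have hz0Q : z0 ∉ insert v S := by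
    intro hh
    exact hin z0 hh hz0v hz0
  obtain ⟨q, hvq, hqz⟩ := F1 h hf (f z)
  have hqv : q ≠ v := hvq.ne'
  have hqS : q ∈ S := (hS q).mpr ⟨hvq, by rw [hqz]; exact hze⟩
  have hqQ : q ∈ insert v S := by simp [hqS]
  have hfuz : f u ≠ f z := hf u z huv hzv huz
  have hqu : q ≠ u := fun hh => hfuz (by rw [← hqz, hh])
  have huq : G.Adj u q := hQcl u hu q hqQ hqu.symm
  have hqz' : q ≠ z := fun hh => hzS (hh ▸ hqS)
  have hrep : Function.update f v (f u) q = Function.update f v (f u) z := by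
    rw [gne q hqv, gne z hzv, hqz]
  have uz0 := F3' h hf' huq huz hqz' hrep (y := z0)
    (by rw [gne q hqv, gne z0 hz0v, hz0, hqz]; exact Ne.symm hze) huz0
  refine caseA' h hQcard hQcl hqQ hz0Q ?_
  intro r hr hrq
  by_cases hru : r = u
  · rw [hru]; exact huz0.symm
  have hur : G.Adj u r := hQcl u hu r hr (Ne.symm hru)
  have ur := F3' h hf' huq huz hqz' hrep (y := r) (by
    rw [gne q hqv]
    by_cases hrv : r = v
    · rw [hrv, Function.update_self, hqz]; exact hfuz
    · rw [gne r hrv]; exact hf r q hrv hqv (hQcl r hr q hqQ hrq)) hur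
  exact star h hf' huz0 hur uz0 ur (fun hh => hz0Q (hh ▸ hr))

open Classical in
theorem conf_B2 (h : Crit G k) {v : V} {f : V → Fin k} {e : Fin k} {Q : Finset V}
    (C : Conf G v f e Q) {z : V} (hz : z ∉ Q) : (nb G z ∩ Q).card ≤ 2 := by
  by_contra hlt
  push Not at hlt
  have hk := h.hk
  have hq0 : ∃ q0 ∈ Q, ¬ G.Adj z q0 := by
    by_contra hcon
    push Not at hcon
    have hv' := C.hv
    exact caseA' h C.hcard C.hcl C.hv hz (fun r hr _ => hcon r hr)
  obtain ⟨q0, hq0Q, hzq0⟩ := hq0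
  obtain ⟨w0, hw0⟩ := Finset.card_pos.mp (by omega : 0 < (nb G z ∩ Q).card)
  rw [Finset.mem_inter, mem_nb] at hw0
  obtain ⟨f, C⟩ := C.shift hw0.2
  obtain ⟨hzv, -⟩ := hw0
  generalize w0 = v at C hzv
  have hf := C.hf
  have hq0v : q0 ≠ v := fun hh => hzq0 (hh ▸ hzv)
  have hsd : (nb G z \ Q).card + (nb G z ∩ Q).card = (nb G z).card :=
    Finset.card_sdiff_add_card_inter _ _
  have hdz := h.hdeg z
  have hlt2 : (insert e ((nb G z \ Q).image f)).card < (Finset.univ : Finset (Fin k)).card := by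
    have a1 := Finset.card_insert_le e ((nb G z \ Q).image f)
    have a2 := Finset.card_image_le (s := nb G z \ Q) (f := f)
    rw [Finset.card_univ, Fintype.card_fin]
    omega
  obtain ⟨d, -, hd⟩ := Finset.exists_mem_notMem_of_card_lt_card hlt2
  simp only [Finset.mem_insert, Finset.mem_image, Finset.mem_sdiff, mem_nb, not_or,
    not_exists, not_and] at hd
  obtain ⟨hde, hd⟩ := hd
  have hq0e := C.hin q0 hq0Q hq0v
  let σ := Equiv.swap (f q0) d
  have σe : σ e = e := Equiv.swap_apply_of_ne_of_ne hq0e.symm (Ne.symm hde)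
  have σq : σ (f q0) = d := Equiv.swap_apply_left _ _
  let g : V → Fin k := fun x => if x = z then d else if x ∈ Q then σ (f x) else f x
  have gz : g z = d := if_pos rfl
  have gQ : ∀ x ∈ Q, g x = σ (f x) := by
    intro x hx
    have : x ≠ z := fun hh => hz (hh ▸ hx)
    simp only [g]; rw [if_neg this, if_pos hx]
  have gO : ∀ x, x ∉ Q → x ≠ z → g x = f x := by
    intro x hx hxz
    simp only [g]; rw [if_neg hxz, if_neg hx]
  have gQe : ∀ x ∈ Q, x ≠ v → g x ≠ e := by
    intro x hx hxv hh
    rw [gQ x hx, ← σe] at hh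
    exact C.hin x hx hxv (σ.injective hh)
  have gQd : ∀ x ∈ Q, x ≠ v → x ≠ q0 → g x ≠ d := by
    intro x hx hxv hxq hh
    rw [gQ x hx, ← σq] at hh
    exact hf x q0 hxv hq0v (C.hcl x hx q0 hq0Q hxq) (σ.injective hh)
  have kzO : ∀ y, y ∉ Q → G.Adj z y → g z ≠ g y := by
    intro y hy hzy
    rw [gz, gO y hy hzy.ne']
    exact fun hh => hd y ⟨hzy, hy⟩ hh.symm
  have kzQ : ∀ y ∈ Q, y ≠ v → G.Adj z y → g z ≠ g y := by
    intro y hy hyv hzy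
    rw [gz]
    exact (gQd y hy hyv (fun hh => hzq0 (hh ▸ hzy))).symm
  have kQO : ∀ x ∈ Q, x ≠ v → ∀ y, y ∉ Q → y ≠ z → G.Adj x y → g x ≠ g y := by
    intro x hx hxv y hy hyz hxy
    rw [gO y hy hyz, C.hout x hx y hy hxy]
    exact gQe x hx hxv
  have hg : PropOff G g v := by
    intro a b ha hb hab
    by_cases haz : a = z
    · subst haz
      by_cases hbQ : b ∈ Q
      · exact kzQ b hbQ hb hab
      · exact kzO b hbQ hab
    by_cases hbz : b = z
    · subst hbz
      by_cases haQ : a ∈ Q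
      · exact (kzQ a haQ ha hab.symm).symm
      · exact (kzO a haQ hab.symm).symm
    by_cases haQ : a ∈ Q <;> by_cases hbQ : b ∈ Q
    · rw [gQ a haQ, gQ b hbQ]
      exact fun hh => hf a b ha hb hab (σ.injective hh)
    · exact kQO a haQ ha b hbQ hbz hab
    · exact (kQO b hbQ hb a haQ haz hab.symm).symm
    · rw [gO a haQ haz, gO b hbQ hbz]; exact hf a b ha hb hab
  obtain ⟨w, hvw, hwe⟩ := F1 h hg e
  have hwQ : w ∉ Q := fun hh => gQe w hh hvw.ne' hwe
  have hvq0 : G.Adj v q0 := C.hcl v C.hv q0 hq0Q hq0v.symm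
  have hq0z : q0 ≠ z := fun hh => hz (hh ▸ hq0Q)
  have gq0 : g q0 = d := by rw [gQ q0 hq0Q]; exact σq
  have hrep : g q0 = g z := by rw [gq0, gz]
  have uw := F3' h hg hvq0 hzv.symm hq0z hrep (y := w) (by rw [hwe, gq0]; exact Ne.symm hde) hvw
  refine caseA' h C.hcard C.hcl hq0Q hwQ ?_
  intro r hr hrq
  by_cases hrv : r = v
  · rw [hrv]; exact hvw.symm
  have hvr : G.Adj v r := C.hcl v C.hv r hr (Ne.symm hrv)
  have ur := F3' h hg hvq0 hzv.symm hq0z hrep (y := r) (by rw [gq0]; exact gQd r hr hrv hrq) hvr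
  exact star h hg hvw hvr uw ur (fun hh => hwQ (hh ▸ hr))

open Classical in
theorem crit_false (h : Crit G k) : False := by
  have hk := h.hk
  obtain ⟨v, f, e, Q, C⟩ := conf_exists h
  have hex : ∀ u ∈ Q, ∃ z, z ∉ Q ∧ G.Adj u z := by
    intro u hu
    obtain ⟨f', C'⟩ := C.shift hu
    obtain ⟨z, huz, hz⟩ := F1 h C'.hf e
    exact ⟨z, fun hh => C'.hin z hh huz.ne' hz, huz⟩
  let N : V → Finset V := fun u => Q.filter (fun r => ∃ z, z ∉ Q ∧ G.Adj u z ∧ G.Adj r z)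
  have hN : ∀ u r, r ∈ N u ↔ r ∈ Q ∧ ∃ z, z ∉ Q ∧ G.Adj u z ∧ G.Adj r z := by
    intro u r; simp [N]
  have hNc : ∀ u ∈ Q, (N u).card ≤ 3 := by
    intro u hu
    have ho : (nb G u \ Q.erase u).card ≤ 2 := by
      apply out_card h
      · rw [Finset.card_erase_of_mem hu, C.hcard]; omega
      · intro r hr
        rw [Finset.mem_erase] at hr
        exact C.hcl u hu r hr.2 hr.1.symm
    have hsub : N u ⊆ insert u ((nb G u \ Q).biUnion (fun z => (nb G z ∩ Q).erase u)) := by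
      intro r hr
      obtain ⟨hrQ, z, hz, huz, hrz⟩ := (hN u r).mp hr
      by_cases hru : r = u
      · simp [hru]
      · rw [Finset.mem_insert, Finset.mem_biUnion]
        right
        refine ⟨z, ?_, ?_⟩
        · simp [mem_nb, huz, hz]
        · simp [mem_nb, hrz.symm, hru, hrQ]
    have ho2 : (nb G u \ Q).card ≤ 2 :=
      le_trans (Finset.card_le_card (Finset.sdiff_subset_sdiff le_rfl (Finset.erase_subset _ _))) ho
    have hb : ((nb G u \ Q).biUnion (fun z => (nb G z ∩ Q).erase u)).card ≤ (nb G u \ Q).card * 1 := by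
      apply Finset.card_biUnion_le_card_mul
      intro z hz
      rw [Finset.mem_sdiff, mem_nb] at hz
      have := conf_B2 h C hz.2
      rw [Finset.card_erase_of_mem (by simp [mem_nb, hz.1.symm, hu])]
      omega
    have := Finset.card_le_card hsub
    have := Finset.card_insert_le u ((nb G u \ Q).biUnion (fun z => (nb G z ∩ Q).erase u))
    omega
  have hu1 := C.hv
  generalize hvu : v = u1 at hu1
  have c1 := hNc u1 hu1
  obtain ⟨u2, hu2, hu2n⟩ := Finset.exists_mem_notMem_of_card_lt_card
    (by rw [C.hcard]; omega : (N u1).card < Q.card)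
  have c2 := hNc u2 hu2
  obtain ⟨u3, hu3, hu3n⟩ := Finset.exists_mem_notMem_of_card_lt_card
    (by rw [C.hcard]; have := Finset.card_union_le (N u1) (N u2); omega :
      (N u1 ∪ N u2).card < Q.card)
  rw [Finset.mem_union, not_or] at hu3n
  obtain ⟨z1, hz1, a1⟩ := hex u1 hu1
  obtain ⟨z2, hz2, a2⟩ := hex u2 hu2
  obtain ⟨z3, hz3, a3⟩ := hex u3 hu3
  have hne : u1 ≠ u2 := by
    rintro rfl
    exact hu2n ((hN _ _).mpr ⟨hu2, z1, hz1, a1, a1⟩)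
  have hzz : ∀ x y a b, x ∉ Q → y ∉ Q → a ∈ Q → b ∈ Q → G.Adj a x → G.Adj b y → ¬ G.Adj x y := by
    intro x y a b hx hy ha hb hax hby hxy
    exact C.hf x y (fun hh => hx (hh ▸ C.hv)) (fun hh => hy (hh ▸ C.hv)) hxy
      ((C.hout a ha x hx hax).trans (C.hout b hb y hy hby).symm)
  refine h.hp z1 u1 u2 z2 z3 a1.symm (C.hcl u1 hu1 u2 hu2 hne) a2 ?_ ?_ ?_ ?_ ?_ ?_ ?_
  · exact fun hh => hu2n ((hN _ _).mpr ⟨hu2, z1, hz1, a1, hh.symm⟩)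
  · exact hzz z1 z2 u1 u2 hz1 hz2 hu1 hu2 a1 a2
  · exact fun hh => hu2n ((hN _ _).mpr ⟨hu2, z2, hz2, hh, a2⟩)
  · exact hzz z3 z1 u3 u1 hz3 hz1 hu3 hu1 a3 a1
  · exact fun hh => hu3n.1 ((hN _ _).mpr ⟨hu3, z3, hz3, hh.symm, a3⟩)
  · exact fun hh => hu3n.2 ((hN _ _).mpr ⟨hu3, z3, hz3, hh.symm, a3⟩)
  · exact hzz z3 z2 u3 u2 hz3 hz2 hu3 hu2 a3 a2
end

open Classical in
theorem colour_of (k : ℕ) (hk : 8 ≤ k) (n : ℕ) : ∀ {V : Type*} [Fintype V] (G : SimpleGraph V),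
    Fintype.card V = n → (∀ v, (nb G v).card ≤ k + 1) →
    (∀ s : Finset V, (∀ a ∈ s, ∀ b ∈ s, a ≠ b → G.Adj a b) → s.card ≤ k) →
    (∀ a b c d x, G.Adj a b → G.Adj b c → G.Adj c d → ¬ G.Adj a c → ¬ G.Adj a d →
      ¬ G.Adj b d → ¬ G.Adj x a → ¬ G.Adj x b → ¬ G.Adj x c → ¬ G.Adj x d → False) →
    ∃ f : V → Fin k, ∀ a b, G.Adj a b → f a ≠ f b := by
  induction n with
  | zero =>
    intro V _ G hn _ _ _
    have := Fintype.card_eq_zero_iff.mp hn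
    exact ⟨fun v => isEmptyElim v, fun v => isEmptyElim v⟩
  | succ n ih =>
    intro V _ G hn hdeg hcl hp
    by_contra hcon
    push Not at hcon
    refine crit_false (G := G) (k := k) ⟨hk, hdeg, hcl, ?_, ?_, hp⟩
    · intro f hf
      obtain ⟨a, b, hab, hh⟩ := hcon f
      exact hf a b hab hh
    · intro v
      obtain ⟨f, hf⟩ := ih (V := {u : V // u ≠ v}) (G.comap Subtype.val)
        (by rw [Fintype.card_subtype_compl, hn, Fintype.card_subtype_eq]; omega)
        (by
          intro u
          refine le_trans ?_ (hdeg u)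
          rw [← Finset.card_map (Function.Embedding.subtype (fun u => u ≠ v))]
          apply Finset.card_le_card
          intro x hx
          rw [Finset.mem_map] at hx
          obtain ⟨y, hy, rfl⟩ := hx
          rw [mem_nb] at hy ⊢
          exact hy)
        (by
          intro s hs
          rw [← Finset.card_map (Function.Embedding.subtype (fun u => u ≠ v))]
          apply hcl
          intro a ha b hb hab
          rw [Finset.mem_map] at ha hb
          obtain ⟨a, ha, rfl⟩ := ha
          obtain ⟨b, hb, rfl⟩ := hb
          exact hs a ha b hb (fun hh => hab (by rw [hh])))
        (by
          intro a b c d x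
          exact hp a b c d x)
      refine ⟨fun u => if hu : u ≠ v then f ⟨u, hu⟩ else ⟨0, by omega⟩, ?_⟩
      intro a b ha hb hab
      simp only [ne_eq, ha, not_false_eq_true, dif_pos, hb]
      exact hf ⟨a, ha⟩ ⟨b, hb⟩ hab

end BK

theorem borodin_kostochka_P4K1_free
    {V : Type*} [Fintype V]
    (G : SimpleGraph V) [DecidableRel G.Adj]
    (hΔ : 9 ≤ G.maxDegree)
    (hfree : ¬ Nonempty (P4UnionK1 ↪g G)) :
    G.chromaticNumber ≤ (↑(max (G.maxDegree - 1) G.cliqueNum) : ℕ∞) := by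
  have hk : 8 ≤ max (G.maxDegree - 1) G.cliqueNum := le_max_of_le_left (by omega)
  obtain ⟨f, hf⟩ := BK.colour_of (max (G.maxDegree - 1) G.cliqueNum) hk (Fintype.card V) G rfl
    (by
      intro v
      have h1 := G.degree_le_maxDegree v
      have h2 : (BK.nb G v).card = G.degree v := by
        rw [← SimpleGraph.card_neighborFinset_eq_degree]
        congr 1
        ext u
        rw [BK.mem_nb, SimpleGraph.mem_neighborFinset]
      have h3 := le_max_left (G.maxDegree - 1) G.cliqueNum
      omega)
    (by
      intro s hs
      refine le_trans (SimpleGraph.IsClique.card_le_cliqueNum (t := s) (tc := ?_)) (le_max_right _ _)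
      intro a ha b hb hab
      exact hs a ha b hb hab)
    (by
      intro a b c d x ab bc cd nac nad nbd nxa nxb nxc nxd
      apply hfree
      have e1 := ab.ne
      have e2 := bc.ne
      have e3 := cd.ne
      have e4 : a ≠ c := fun e => nad (e ▸ cd)
      have e5 : a ≠ d := fun e => nac (e ▸ cd.symm)
      have e6 : b ≠ d := fun e => nad (e ▸ ab)
      have e7 : x ≠ a := fun e => nxb (e ▸ ab)
      have e8 : x ≠ b := fun e => nxa (e ▸ ab.symm)
      have e9 : x ≠ c := fun e => nxd (e ▸ cd)
      have e10 : x ≠ d := fun e => nxc (e ▸ cd.symm)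
      have s1 := ab.symm
      have s2 := bc.symm
      have s3 := cd.symm
      have n1 : ¬ G.Adj c a := fun e => nac e.symm
      have n2 : ¬ G.Adj d a := fun e => nad e.symm
      have n3 : ¬ G.Adj d b := fun e => nbd e.symm
      have n4 : ¬ G.Adj a x := fun e => nxa e.symm
      have n5 : ¬ G.Adj b x := fun e => nxb e.symm
      have n6 : ¬ G.Adj c x := fun e => nxc e.symm
      have n7 : ¬ G.Adj d x := fun e => nxd e.symm
      refine ⟨⟨⟨![a, b, c, d, x], ?_⟩, ?_⟩⟩
      · intro i j hij
        fin_cases i <;> fin_cases j <;> simp at hij ⊢ <;>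
          first | exact absurd hij (by assumption) | exact absurd hij.symm (by assumption)
      · intro i j
        change G.Adj (![a, b, c, d, x] i) (![a, b, c, d, x] j) ↔ P4UnionK1.Adj i j
        fin_cases i <;> fin_cases j <;> simp [P4UnionK1, *])
  exact (SimpleGraph.Coloring.colorable (SimpleGraph.Coloring.mk f
    (fun {a b} hab => hf a b hab)) |> fun h => by simpa using h.chromaticNumber_le)
end
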